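/- arXiv:2203.14791 — 15 statements merged into one kernel-verified Lean document; each statement's English description precedes it below -/
import Mathlib

section
/- Let λ > 0 and γ ≥ 0. The function w_S is convex on the interval [0, π], and its second derivative tends to 0 as x → π from the left (equivalently, β²·w_S(π−x) − α²·κ₄·sinh(α(x−π/2)) → 0 as x → π⁻). -/
open Real Set Filter

noncomputable def alph (lam gam : ℝ) : ℝ := Real.sqrt (2 * (2 * lam + gam))

noncomputable def bet (gam : ℝ) : ℝ := Real.sqrt (2 * gam)

noncomputable def kappa3 (lam gam : ℝ) : ℝ :=
  (1 / Real.cosh (bet gam * (π / 2))) *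
    ((bet gam / (2 * alph lam gam)) * (1 / Real.sinh (alph lam gam * (π / 2)))
      + Real.sinh (bet gam * (π / 2)))

noncomputable def kappa4 (lam gam : ℝ) : ℝ :=
  (bet gam / alph lam gam) ^ 2 * (1 / Real.sinh (alph lam gam * (π / 2)))

noncomputable def wS (lam gam : ℝ) (x : ℝ) : ℝ :=
  if x ≤ π / 2 then
    Real.cosh (bet gam * x) - kappa3 lam gam * Real.sinh (bet gam * x)
  else
    (Real.cosh (bet gam * (π - x)) - kappa3 lam gam * Real.sinh (bet gam * (π - x)))
      - kappa4 lam gam * Real.sinh (alph lam gam * (x - π / 2))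

lemma aux_m (a b : ℝ) (hb : 0 ≤ b) (hab : b ≤ a) (t : ℝ) (ht : 0 ≤ t) :
    0 ≤ a * Real.cosh (a * t) * Real.sinh (b * t) - b * Real.sinh (a * t) * Real.cosh (b * t) := by
  have hd : ∀ x : ℝ, HasDerivAt (fun t => a * Real.cosh (a * t) * Real.sinh (b * t)
      - b * Real.sinh (a * t) * Real.cosh (b * t))
      ((a ^ 2 - b ^ 2) * (Real.sinh (a * x) * Real.sinh (b * x))) x := by
    intro x
    have ha' : HasDerivAt (fun t => a * t) a x := by simpa using (hasDerivAt_id x).const_mul a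
    have hb' : HasDerivAt (fun t => b * t) b x := by simpa using (hasDerivAt_id x).const_mul b
    refine HasDerivAt.congr_deriv (((ha'.cosh.const_mul a).mul hb'.sinh).sub ((ha'.sinh.const_mul b).mul hb'.cosh)) ?_
    ring
  have hm := monotoneOn_of_deriv_nonneg (convex_Ici (0:ℝ))
    (fun x _ => (hd x).continuousAt.continuousWithinAt)
    (fun x _ => (hd x).differentiableAt.differentiableWithinAt)
    (by
      intro x hx
      rw [interior_Ici, mem_Ioi] at hx
      rw [(hd x).deriv]
      have h1 : 0 ≤ Real.sinh (a * x) := Real.sinh_nonneg_iff.2 (mul_nonneg (hb.trans hab) hx.le)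
      have h2 : 0 ≤ Real.sinh (b * x) := Real.sinh_nonneg_iff.2 (mul_nonneg hb hx.le)
      have h3 : 0 ≤ a ^ 2 - b ^ 2 := by nlinarith
      positivity)
  have := hm (mem_Ici.2 le_rfl) (mem_Ici.2 ht) ht
  simpa using this

lemma aux_ratio (a b : ℝ) (hb : 0 < b) (hab : b ≤ a) (t c : ℝ) (ht : 0 ≤ t) (htc : t ≤ c) :
    Real.sinh (a * t) * Real.sinh (b * c) ≤ Real.sinh (b * t) * Real.sinh (a * c) := by
  rcases ht.eq_or_lt with rfl | ht
  · simp
  have hs : ∀ x : ℝ, 0 < x → 0 < Real.sinh (b * x) := fun x hx => Real.sinh_pos_iff.2 (by positivity)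
  have hd : ∀ x : ℝ, 0 < x → HasDerivAt (fun t => Real.sinh (a * t) / Real.sinh (b * t))
      ((a * Real.cosh (a * x) * Real.sinh (b * x) - b * Real.sinh (a * x) * Real.cosh (b * x))
        / Real.sinh (b * x) ^ 2) x := by
    intro x hx
    have ha' : HasDerivAt (fun t => a * t) a x := by simpa using (hasDerivAt_id x).const_mul a
    have hb' : HasDerivAt (fun t => b * t) b x := by simpa using (hasDerivAt_id x).const_mul b
    refine HasDerivAt.congr_deriv (ha'.sinh.div hb'.sinh (hs x hx).ne') ?_
    ring
  have hm := monotoneOn_of_deriv_nonneg (convex_Ioi (0:ℝ))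
    (fun x hx => (hd x hx).continuousAt.continuousWithinAt)
    (fun x hx => (hd x (interior_subset hx)).differentiableAt.differentiableWithinAt)
    (by
      intro x hx
      have hx := interior_subset hx
      rw [(hd x hx).deriv]
      exact div_nonneg (aux_m a b hb.le hab x (le_of_lt hx)) (sq_nonneg _))
  have := hm (mem_Ioi.2 ht) (mem_Ioi.2 (ht.trans_le htc)) htc
  simp only at this
  rw [div_le_div_iff₀ (hs t ht) (hs c (ht.trans_le htc))] at this
  linarith

lemma aux_glue (c e : ℝ) (f g f' g' f'' g'' : ℝ → ℝ) (hc : 0 < c) (hce : c < e)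
    (hf : ∀ x, HasDerivAt f (f' x) x) (hg : ∀ x, HasDerivAt g (g' x) x)
    (hf' : ∀ x, HasDerivAt f' (f'' x) x) (hg' : ∀ x, HasDerivAt g' (g'' x) x)
    (h0 : f c = g c) (h1 : f' c = g' c)
    (hf2 : ∀ x, 0 ≤ x → x ≤ c → 0 ≤ f'' x) (hg2 : ∀ x, c ≤ x → x ≤ e → 0 ≤ g'' x) :
    ConvexOn ℝ (Icc 0 e) (fun x => if x ≤ c then f x else g x) := by
  set w : ℝ → ℝ := fun x => if x ≤ c then f x else g x with hw
  have hwl : ∀ x, x ≤ c → w x = f x := fun x hx => if_pos hx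
  have hwr : ∀ x, c ≤ x → w x = g x := by
    intro x hx
    rcases hx.eq_or_lt with rfl | hx
    · rw [hwl _ le_rfl, h0]
    · exact if_neg hx.not_ge
  have hl : ∀ x, x ≤ c → HasDerivWithinAt w (f' x) (Iic c) x := fun x hx =>
    ((hf x).hasDerivWithinAt).congr (fun y hy => hwl y hy) (hwl x hx)
  have hr : ∀ x, c ≤ x → HasDerivWithinAt w (g' x) (Ici c) x := fun x hx =>
    ((hg x).hasDerivWithinAt).congr (fun y hy => hwr y hy) (hwr x hx)
  have dl : ∀ x, x ≤ c → HasDerivAt w (f' x) x := by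
    intro x hx
    rcases hx.eq_or_lt with rfl | hx
    · have := (hl x le_rfl).union (h1 ▸ hr x le_rfl)
      rwa [Iic_union_Ici, hasDerivWithinAt_univ] at this
    · exact (hl x hx.le).hasDerivAt (Iic_mem_nhds hx)
  have dr : ∀ x, c ≤ x → HasDerivAt w (g' x) x := by
    intro x hx
    rcases hx.eq_or_lt with rfl | hx
    · exact h1 ▸ dl c le_rfl
    · exact (hr x hx.le).hasDerivAt (Ici_mem_nhds hx)
  have dw : Differentiable ℝ w := fun x => (le_total x c).elim
    (fun h => (dl x h).differentiableAt) (fun h => (dr x h).differentiableAt)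
  have ml : MonotoneOn (deriv w) (Icc 0 c) := by
    have : MonotoneOn f' (Icc 0 c) := monotoneOn_of_deriv_nonneg (convex_Icc _ _)
      (fun x _ => (hf' x).continuousAt.continuousWithinAt)
      (fun x _ => (hf' x).differentiableAt.differentiableWithinAt)
      (fun x hx => by
        rw [(hf' x).deriv]
        exact hf2 x (interior_subset hx).1 (interior_subset hx).2)
    exact this.congr (fun x hx => (dl x hx.2).deriv.symm)
  have mr : MonotoneOn (deriv w) (Icc c e) := by
    have : MonotoneOn g' (Icc c e) := monotoneOn_of_deriv_nonneg (convex_Icc _ _)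
      (fun x _ => (hg' x).continuousAt.continuousWithinAt)
      (fun x _ => (hg' x).differentiableAt.differentiableWithinAt)
      (fun x hx => by
        rw [(hg' x).deriv]
        exact hg2 x (interior_subset hx).1 (interior_subset hx).2)
    exact this.congr (fun x hx => (dr x hx.1).deriv.symm)
  have mw : MonotoneOn (deriv w) (Icc 0 e) := by
    have := ml.union_right mr (isGreatest_Icc hc.le) (isLeast_Icc hce.le)
    rwa [Icc_union_Icc_eq_Icc hc.le hce.le] at this
  exact MonotoneOn.convexOn_of_deriv (convex_Icc _ _) dw.continuous.continuousOn
    dw.differentiableOn (mw.mono interior_subset)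

lemma aux_main (a b c k3 k4 : ℝ) (ha : 0 < a) (hb : 0 ≤ b) (hab : b ≤ a) (hc : 0 < c)
    (hk3 : k3 = (1 / Real.cosh (b * c)) *
      ((b / (2 * a)) * (1 / Real.sinh (a * c)) + Real.sinh (b * c)))
    (hk4 : k4 = (b / a) ^ 2 * (1 / Real.sinh (a * c))) :
    ConvexOn ℝ (Icc 0 (2 * c)) (fun x => if x ≤ c then
      Real.cosh (b * x) - k3 * Real.sinh (b * x) else
      (Real.cosh (b * (2 * c - x)) - k3 * Real.sinh (b * (2 * c - x)))
        - k4 * Real.sinh (a * (x - c))) := by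
  have hS : 0 < Real.sinh (a * c) := Real.sinh_pos_iff.2 (by positivity)
  have hC : 0 < Real.cosh (b * c) := Real.cosh_pos _
  have hak : a ^ 2 * k4 = b ^ 2 / Real.sinh (a * c) := by rw [hk4]; field_simp
  -- key inequality
  have key : ∀ y, 0 ≤ y → y ≤ c → 0 ≤ b ^ 2 *
      ((Real.cosh (b * y) - k3 * Real.sinh (b * y)) - Real.sinh (a * (c - y)) / Real.sinh (a * c)) := by
    intro y hy hyc
    rcases hb.eq_or_lt with rfl | hb
    · simp
    apply mul_nonneg (sq_nonneg _)
    have hs : 0 < Real.sinh (b * c) := Real.sinh_pos_iff.2 (by positivity)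
    have hle : Real.sinh (b * c) ≤ Real.sinh (a * c) := Real.sinh_le_sinh.2 (by gcongr)
    have hu : 0 ≤ Real.cosh (b * c) - k3 * Real.sinh (b * c) := by
      have h1 : b / (2 * a) * (1 / Real.sinh (a * c)) * Real.sinh (b * c) ≤ 1 := by
        have e1 : b / (2 * a) ≤ 1 := by rw [div_le_one (by positivity)]; linarith
        have e2 : Real.sinh (b * c) / Real.sinh (a * c) ≤ 1 := by rwa [div_le_one hS]
        calc _ = b / (2 * a) * (Real.sinh (b * c) / Real.sinh (a * c)) := by ring
          _ ≤ 1 := mul_le_one₀ e1 (by positivity) e2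
      have h2 : Real.cosh (b * c) - k3 * Real.sinh (b * c) =
          (1 - b / (2 * a) * (1 / Real.sinh (a * c)) * Real.sinh (b * c)) / Real.cosh (b * c) := by
        rw [hk3, eq_div_iff hC.ne']
        have := Real.cosh_sq (b * c)
        generalize b / (2 * a) * (1 / Real.sinh (a * c)) = q
        field_simp
        linear_combination this
      rw [h2]
      exact div_nonneg (by linarith) hC.le
    have hr := aux_ratio a b hb hab (c - y) c (by linarith) (by linarith)
    have hsy : 0 ≤ Real.sinh (b * y) := Real.sinh_nonneg_iff.2 (by positivity)
    have e : Real.sinh (b * (c - y)) = Real.sinh (b * c) * Real.cosh (b * y)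
        - Real.cosh (b * c) * Real.sinh (b * y) := by rw [mul_sub, Real.sinh_sub]
    rw [sub_nonneg, div_le_iff₀ hS]
    refine le_of_mul_le_mul_right (hr.trans ?_) hs
    rw [e]
    have := mul_nonneg (mul_nonneg hu hsy) hS.le
    linarith
  have hu' : ∀ y, 0 ≤ y → y ≤ c → 0 ≤ b ^ 2 * (Real.cosh (b * y) - k3 * Real.sinh (b * y)) := by
    intro y hy hyc
    have h1 := key y hy hyc
    have h2 : 0 ≤ Real.sinh (a * (c - y)) / Real.sinh (a * c) :=
      div_nonneg (Real.sinh_nonneg_iff.2 (mul_nonneg ha.le (by linarith))) hS.le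
    have := mul_nonneg (sq_nonneg b) h2
    linarith
  have hb' : ∀ x : ℝ, HasDerivAt (fun t => b * t) b x := fun x => by
    simpa using (hasDerivAt_id x).const_mul b
  have hr' : ∀ x : ℝ, HasDerivAt (fun t => b * (2 * c - t)) (-b) x := fun x => by
    simpa using ((hasDerivAt_id x).const_sub (2 * c)).const_mul b
  have ha' : ∀ x : ℝ, HasDerivAt (fun t => a * (t - c)) a x := fun x => by
    simpa using ((hasDerivAt_id x).sub_const c).const_mul a
  refine aux_glue c (2 * c) _ _
    (fun x => b * Real.sinh (b * x) - k3 * (b * Real.cosh (b * x)))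
    (fun x => -(b * Real.sinh (b * (2 * c - x)) - k3 * (b * Real.cosh (b * (2 * c - x))))
      - k4 * (a * Real.cosh (a * (x - c))))
    (fun x => b ^ 2 * (Real.cosh (b * x) - k3 * Real.sinh (b * x)))
    (fun x => b ^ 2 * (Real.cosh (b * (2 * c - x)) - k3 * Real.sinh (b * (2 * c - x)))
      - a ^ 2 * k4 * Real.sinh (a * (x - c))) hc (by linarith) ?_ ?_ ?_ ?_ ?_ ?_ hu' ?_
  · intro x
    refine HasDerivAt.congr_deriv ((hb' x).cosh.sub ((hb' x).sinh.const_mul k3)) ?_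
    ring
  · intro x
    refine HasDerivAt.congr_deriv (((hr' x).cosh.sub ((hr' x).sinh.const_mul k3)).sub ((ha' x).sinh.const_mul k4)) ?_
    ring
  · intro x
    refine HasDerivAt.congr_deriv (((hb' x).sinh.const_mul b).sub (((hb' x).cosh.const_mul b).const_mul k3)) ?_
    ring
  · intro x
    refine HasDerivAt.congr_deriv ((((hr' x).sinh.const_mul b).sub (((hr' x).cosh.const_mul b).const_mul k3)).neg.sub
      (((ha' x).cosh.const_mul a).const_mul k4)) ?_
    ring
  · have : 2 * c - c = c := by ring
    simp [this]
  · have : 2 * c - c = c := by ring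
    simp only [this, sub_self, mul_zero, Real.cosh_zero]
    rw [hk3, hk4]
    field_simp
    ring
  · intro x hx hx2
    have h := key (2 * c - x) (by linarith) (by linarith)
    have e : c - (2 * c - x) = x - c := by ring
    rw [e] at h
    simp only [hak]
    convert h using 1
    ring

/-- For `λ > 0` and `γ ≥ 0`, the function `w_S` is convex on `[0, π]`, and its second
derivative `β² w_S(π−x) − α² κ₄ sinh(α(x−π/2))` tends to `0` as `x → π⁻`. -/
theorem stmt0 (lam gam : ℝ) (hlam : 0 < lam) (hgam : 0 ≤ gam) :
    ConvexOn ℝ (Icc 0 π) (wS lam gam) ∧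
    Tendsto (fun x : ℝ =>
        (bet gam) ^ 2 * wS lam gam (π - x)
          - (alph lam gam) ^ 2 * kappa4 lam gam * Real.sinh (alph lam gam * (x - π / 2)))
      (nhdsWithin π (Iio π)) (nhds 0) := by
  have ha : 0 < alph lam gam := Real.sqrt_pos.2 (by positivity)
  have hb : 0 ≤ bet gam := Real.sqrt_nonneg _
  have hab : bet gam ≤ alph lam gam := Real.sqrt_le_sqrt (by linarith)
  have hc : 0 < π / 2 := by positivity
  constructor
  · have h := aux_main (alph lam gam) (bet gam) (π / 2) (kappa3 lam gam) (kappa4 lam gam)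
      ha hb hab hc rfl rfl
    have e : 2 * (π / 2) = π := by ring
    rw [e] at h
    exact h
  · have hS : 0 < Real.sinh (alph lam gam * (π / 2)) := Real.sinh_pos_iff.2 (by positivity)
    have hcont : Continuous (fun x : ℝ => (bet gam) ^ 2 *
        (Real.cosh (bet gam * (π - x)) - kappa3 lam gam * Real.sinh (bet gam * (π - x)))
          - (alph lam gam) ^ 2 * kappa4 lam gam * Real.sinh (alph lam gam * (x - π / 2))) := by
      have := Real.continuous_sinh
      have := Real.continuous_cosh
      fun_prop
    have ht := (hcont.tendsto π).mono_left (nhdsWithin_le_nhds (s := Iio π))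
    have e : π - π / 2 = π / 2 := by ring
    have hz : (bet gam) ^ 2 *
        (Real.cosh (bet gam * (π - π)) - kappa3 lam gam * Real.sinh (bet gam * (π - π)))
          - (alph lam gam) ^ 2 * kappa4 lam gam * Real.sinh (alph lam gam * (π - π / 2)) = 0 := by
      rw [e, sub_self, mul_zero, Real.cosh_zero, Real.sinh_zero, kappa4]
      field_simp
      ring
    rw [hz] at ht
    refine ht.congr' ?_
    have : ∀ᶠ x in nhdsWithin π (Iio π), π / 2 < x :=
      nhdsWithin_le_nhds (Ioi_mem_nhds (by linarith))
    filter_upwards [this] with x hx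
    rw [wS, if_pos (by linarith)]
end

section
/- Let α and β be real numbers with 0 < β ≤ α, and write c_u = cosh(uπ/2), s_u = sinh(uπ/2). Then for every x ∈ [π/2, π], s_β·c_β·cosh(β(π−x)) − (β·s_β/(2α·s_α) + s_β²)·sinh(β(π−x)) − (s_β·c_β/s_α)·sinh(α(x−π/2)) ≥ (1/2)·sinh(β(π−x)) ≥ 0. -/
open Real Set

lemma aux1 (u h : ℝ) (hu : 0 ≤ u) (huh : u ≤ h) (y : ℝ) (hy : 0 ≤ y) :
    u * Real.cosh (y * u) * Real.sinh (y * h) - h * Real.sinh (y * u) * Real.cosh (y * h) ≤ 0 := by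
  have hd : ∀ z : ℝ, HasDerivAt (fun z : ℝ => u * Real.cosh (z * u) * Real.sinh (z * h)
      - h * Real.sinh (z * u) * Real.cosh (z * h))
      ((u ^ 2 - h ^ 2) * (Real.sinh (z * u) * Real.sinh (z * h))) z := by
    intro z
    have h1 : HasDerivAt (fun z : ℝ => z * u) u z := hasDerivAt_mul_const u
    have h2 : HasDerivAt (fun z : ℝ => z * h) h z := hasDerivAt_mul_const h
    refine HasDerivAt.congr_deriv (((h1.cosh.const_mul u).mul h2.sinh).sub ((h1.sinh.const_mul h).mul h2.cosh)) ?_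
    ring
  have hanti : AntitoneOn (fun z : ℝ => u * Real.cosh (z * u) * Real.sinh (z * h)
      - h * Real.sinh (z * u) * Real.cosh (z * h)) (Ici 0) := by
    apply antitoneOn_of_deriv_nonpos (convex_Ici 0)
    · exact fun z _ => (hd z).continuousAt.continuousWithinAt
    · exact fun z _ => (hd z).differentiableAt.differentiableWithinAt
    · intro z hz
      rw [interior_Ici, mem_Ioi] at hz
      rw [(hd z).deriv]
      have h1 : 0 ≤ Real.sinh (z * u) := Real.sinh_nonneg_iff.2 (by positivity)
      have h2 : 0 ≤ Real.sinh (z * h) := Real.sinh_nonneg_iff.2 (mul_nonneg hz.le (hu.trans huh))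
      exact mul_nonpos_of_nonpos_of_nonneg (by nlinarith) (mul_nonneg h1 h2)
  have := hanti (mem_Ici.2 le_rfl) (mem_Ici.2 hy) hy
  simpa using this

lemma aux2 (u h a b : ℝ) (hh : 0 < h) (hu : 0 ≤ u) (huh : u ≤ h) (hb : 0 < b) (hba : b ≤ a) :
    Real.sinh (a * u) / Real.sinh (a * h) ≤ Real.sinh (b * u) / Real.sinh (b * h) := by
  have hp : ∀ z : ℝ, 0 < z → 0 < Real.sinh (z * h) := fun z hz =>
    Real.sinh_pos_iff.2 (by positivity)
  have hd : ∀ z : ℝ, 0 < z → HasDerivAt (fun z : ℝ => Real.sinh (z * u) / Real.sinh (z * h))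
      ((u * Real.cosh (z * u) * Real.sinh (z * h) - h * Real.sinh (z * u) * Real.cosh (z * h))
        / Real.sinh (z * h) ^ 2) z := by
    intro z hz
    have h1 : HasDerivAt (fun z : ℝ => z * u) u z := hasDerivAt_mul_const u
    have h2 : HasDerivAt (fun z : ℝ => z * h) h z := hasDerivAt_mul_const h
    refine HasDerivAt.congr_deriv (h1.sinh.div h2.sinh (hp z hz).ne') ?_
    ring
  have hanti : AntitoneOn (fun z : ℝ => Real.sinh (z * u) / Real.sinh (z * h)) (Ioi 0) := by
    apply antitoneOn_of_deriv_nonpos (convex_Ioi 0)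
    · exact fun z hz => (hd z hz).continuousAt.continuousWithinAt
    · intro z hz
      rw [interior_Ioi] at hz
      exact (hd z hz).differentiableAt.differentiableWithinAt
    · intro z hz
      rw [interior_Ioi] at hz
      rw [(hd z hz).deriv]
      exact div_nonpos_of_nonpos_of_nonneg (aux1 u h hu huh z (le_of_lt hz)) (sq_nonneg _)
  exact hanti (mem_Ioi.2 hb) (mem_Ioi.2 (hb.trans_le hba)) hba

/-- For `0 < β ≤ α`, with `c_u = cosh(uπ/2)` and `s_u = sinh(uπ/2)`, for every
`x ∈ [π/2, π]` we have
`s_β c_β cosh(β(π−x)) − (β s_β/(2α s_α) + s_β²) sinh(β(π−x)) − (s_β c_β/s_α) sinh(α(x−π/2))`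
`≥ (1/2) sinh(β(π−x)) ≥ 0`. -/
theorem stmt1 (a b : ℝ) (hb : 0 < b) (hba : b ≤ a) (x : ℝ) (hx : x ∈ Icc (π / 2) π) :
    (1 / 2) * Real.sinh (b * (π - x)) ≥ 0 ∧
    Real.sinh (b * (π / 2)) * Real.cosh (b * (π / 2)) * Real.cosh (b * (π - x))
      - (b * Real.sinh (b * (π / 2)) / (2 * a * Real.sinh (a * (π / 2)))
          + Real.sinh (b * (π / 2)) ^ 2) * Real.sinh (b * (π - x))
      - (Real.sinh (b * (π / 2)) * Real.cosh (b * (π / 2)) / Real.sinh (a * (π / 2)))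
          * Real.sinh (a * (x - π / 2))
      ≥ (1 / 2) * Real.sinh (b * (π - x)) := by
  obtain ⟨hx1, hx2⟩ := hx
  have hpi := Real.pi_pos
  have ha : 0 < a := hb.trans_le hba
  have hT : 0 ≤ Real.sinh (b * (π - x)) :=
    Real.sinh_nonneg_iff.2 (mul_nonneg hb.le (by linarith))
  refine ⟨by positivity, ?_⟩
  have key := aux2 (x - π / 2) (π / 2) a b (by positivity) (by linarith) (by linarith) hb hba
  have hs : 0 < Real.sinh (b * (π / 2)) := Real.sinh_pos_iff.2 (by positivity)
  have hS : 0 < Real.sinh (a * (π / 2)) := Real.sinh_pos_iff.2 (by positivity)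
  have hsS : Real.sinh (b * (π / 2)) ≤ Real.sinh (a * (π / 2)) :=
    Real.sinh_le_sinh.2 (by gcongr)
  have hc : 0 < Real.cosh (b * (π / 2)) := Real.cosh_pos _
  have hid : Real.sinh (b * (x - π / 2)) = Real.sinh (b * (π / 2)) * Real.cosh (b * (π - x))
      - Real.cosh (b * (π / 2)) * Real.sinh (b * (π - x)) := by
    rw [← Real.sinh_sub]; congr 1; ring
  have hcs := Real.cosh_sq (b * (π / 2))
  have hr : b * Real.sinh (b * (π / 2)) / (2 * a * Real.sinh (a * (π / 2))) ≤ 1 / 2 := by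
    rw [div_le_iff₀ (by positivity)]
    have := mul_le_mul hba hsS hs.le ha.le
    linarith
  rw [hid, le_div_iff₀ hs] at key
  have k2 := mul_le_mul_of_nonneg_left key hc.le
  have k3 := mul_le_mul_of_nonneg_right hr hT
  have e : Real.sinh (b * (π / 2)) * Real.cosh (b * (π / 2)) / Real.sinh (a * (π / 2))
      * Real.sinh (a * (x - π / 2)) = Real.cosh (b * (π / 2)) * (Real.sinh (a * (x - π / 2))
      / Real.sinh (a * (π / 2)) * Real.sinh (b * (π / 2))) := by ring
  rw [e]
  have e2 : Real.cosh (b * (π / 2)) ^ 2 * Real.sinh (b * (π - x)) =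
      (Real.sinh (b * (π / 2)) ^ 2 + 1) * Real.sinh (b * (π - x)) := by rw [hcs]
  linarith
end

section
/- There exists a unique real number λ > 0 satisfying cosech(π√λ) + 2π√λ = 2·coth(π√λ); moreover this unique solution λ* satisfies 0.083 < λ* < 0.084. -/
open Real Set

lemma aux_mono : StrictMonoOn (fun u : ℝ => 2 * u * Real.sinh u + 1 - 2 * Real.cosh u) (Ici 0) := by
  apply strictMonoOn_of_deriv_pos (convex_Ici 0)
  · fun_prop
  · intro x hx
    rw [interior_Ici] at hx
    have hx' : 0 < x := hx
    have h : HasDerivAt (fun u : ℝ => 2 * u * Real.sinh u + 1 - 2 * Real.cosh u)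
        ((2 * 1) * Real.sinh x + 2 * x * Real.cosh x - 2 * Real.sinh x) x :=
      ((((hasDerivAt_id x).const_mul 2).mul (Real.hasDerivAt_sinh x)).add_const 1).sub
        ((Real.hasDerivAt_cosh x).const_mul 2)
    rw [h.deriv]
    have := mul_pos hx' (Real.cosh_pos x)
    linarith

lemma aux_lo : 2 * (0.906:ℝ) * Real.sinh 0.906 + 1 - 2 * Real.cosh 0.906 < 0 := by
  have h1 := Real.sum_le_exp_of_nonneg (x := 0.906) (by norm_num) 9
  have h2 := Real.exp_bound' (x := 0.906) (by norm_num) (by norm_num) (n := 9) (by norm_num)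
  norm_num [Finset.sum_range_succ, Nat.factorial] at h1 h2
  have h3 : Real.exp (0.906:ℝ) ≤ 2.47442 := by norm_num; linarith
  have h4 : (2.4743:ℝ) ≤ Real.exp 0.906 := by norm_num; linarith
  have h5 : (1/2.47442:ℝ) ≤ Real.exp (-0.906) := by
    rw [Real.exp_neg, ← one_div]
    exact one_div_le_one_div_of_le (Real.exp_pos _) h3
  rw [Real.sinh_eq, Real.cosh_eq]
  norm_num at *
  linarith

lemma aux_hi : 0 < 2 * (0.908:ℝ) * Real.sinh 0.908 + 1 - 2 * Real.cosh 0.908 := by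
  have h1 := Real.sum_le_exp_of_nonneg (x := 0.908) (by norm_num) 9
  have h2 := Real.exp_bound' (x := 0.908) (by norm_num) (by norm_num) (n := 9) (by norm_num)
  norm_num [Finset.sum_range_succ, Nat.factorial] at h1 h2
  have h3 : Real.exp (0.908:ℝ) ≤ 2.4794 := by norm_num; linarith
  have h4 : (2.4793:ℝ) ≤ Real.exp 0.908 := by norm_num; linarith
  have h5 : Real.exp (-0.908) ≤ (1/2.4793:ℝ) := by
    rw [Real.exp_neg, ← one_div]
    exact one_div_le_one_div_of_le (by norm_num) h4
  rw [Real.sinh_eq, Real.cosh_eq]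
  norm_num at *
  linarith

lemma aux_iff (l : ℝ) (hl : 0 < l) :
    (1 / Real.sinh (π * Real.sqrt l) + 2 * π * Real.sqrt l
        = 2 * (Real.cosh (π * Real.sqrt l) / Real.sinh (π * Real.sqrt l))) ↔
    2 * (π * Real.sqrt l) * Real.sinh (π * Real.sqrt l) + 1 - 2 * Real.cosh (π * Real.sqrt l) = 0 := by
  have hs : 0 < Real.sinh (π * Real.sqrt l) :=
    Real.sinh_pos_iff.2 (mul_pos Real.pi_pos (Real.sqrt_pos.2 hl))
  have hs' := hs.ne'
  rw [mul_assoc 2 π]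
  generalize π * Real.sqrt l = u at *
  field_simp
  constructor <;> intro h <;> linarith

/-- There exists a unique `λ > 0` with `cosech(π√λ) + 2π√λ = 2 coth(π√λ)`, and this
unique solution lies in `(0.083, 0.084)`. -/
theorem stmt3 :
    (∃! l : ℝ, 0 < l ∧
      1 / Real.sinh (π * Real.sqrt l) + 2 * π * Real.sqrt l
        = 2 * (Real.cosh (π * Real.sqrt l) / Real.sinh (π * Real.sqrt l))) ∧
    ∀ l : ℝ, (0 < l ∧
      1 / Real.sinh (π * Real.sqrt l) + 2 * π * Real.sqrt l
        = 2 * (Real.cosh (π * Real.sqrt l) / Real.sinh (π * Real.sqrt l))) →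
      0.083 < l ∧ l < 0.084 := by
  obtain ⟨u, ⟨hu1, hu2⟩, hu⟩ := intermediate_value_Icc (a := (0.906:ℝ)) (b := 0.908) (by norm_num)
    (f := fun u : ℝ => 2 * u * Real.sinh u + 1 - 2 * Real.cosh u) (by fun_prop)
    (show (0:ℝ) ∈ _ from ⟨aux_lo.le, aux_hi.le⟩)
  have hu0 : 0 < u := lt_of_lt_of_le (by norm_num) hu1
  have key : ∀ l : ℝ, (0 < l ∧
      1 / Real.sinh (π * Real.sqrt l) + 2 * π * Real.sqrt l
        = 2 * (Real.cosh (π * Real.sqrt l) / Real.sinh (π * Real.sqrt l))) →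
      l = (u / π) ^ 2 := by
    rintro l ⟨hl, h⟩
    rw [aux_iff l hl] at h
    have h' := aux_mono.injOn (mem_Ici.2 (by positivity)) (mem_Ici.2 hu0.le) (h.trans hu.symm)
    rw [← h', mul_div_cancel_left₀ _ Real.pi_pos.ne', Real.sq_sqrt hl.le]
  have hpos : 0 < u / π := div_pos hu0 Real.pi_pos
  refine ⟨⟨(u / π) ^ 2, ⟨by positivity, ?_⟩, key⟩, ?_⟩
  · rw [aux_iff _ (by positivity), Real.sqrt_sq hpos.le, mul_div_cancel₀ _ Real.pi_pos.ne']
    exact hu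
  · intro l hl
    rw [key l hl]
    have p1 := Real.pi_gt_d4
    have p2 := Real.pi_lt_d4
    have a1 : 0.2882 < u / π := by
      rw [lt_div_iff₀ Real.pi_pos]; norm_num at *; linarith
    have a2 : u / π < 0.2891 := by
      rw [div_lt_iff₀ Real.pi_pos]; norm_num at *; linarith
    constructor <;> norm_num at * <;> nlinarith
end

section
/- The function g(λ) = π + cosech(π√λ)/(2√λ) − coth(π√λ)/√λ is strictly increasing on (0, ∞), and for λ > 0 one has g(λ) = 0 if and only if λ = λ*. -/
open Real Set

lemma aux_anti : StrictAntiOn (fun x : ℝ => (2 * Real.cosh x - 1) / (2 * (x * Real.sinh x))) (Ioi 0) := by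
  have hd : ∀ x : ℝ, 0 < x → HasDerivAt (fun x : ℝ => (2 * Real.cosh x - 1) / (2 * (x * Real.sinh x)))
      (((2 * Real.sinh x) * (2 * (x * Real.sinh x)) - (2 * Real.cosh x - 1) *
        (2 * (1 * Real.sinh x + x * Real.cosh x))) / (2 * (x * Real.sinh x)) ^ 2) x := by
    intro x hx
    have hs : 0 < Real.sinh x := Real.sinh_pos_iff.mpr hx
    exact (((Real.hasDerivAt_cosh x).const_mul 2).sub_const 1).div
      (((hasDerivAt_id' x).mul (Real.hasDerivAt_sinh x)).const_mul 2) (by positivity)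
  apply strictAntiOn_of_deriv_neg (convex_Ioi 0)
  · intro x hx
    exact (hd x hx).continuousAt.continuousWithinAt
  · intro x hx
    rw [interior_Ioi] at hx
    have hx0 : 0 < x := hx
    rw [(hd x hx0).deriv]
    have hs : 0 < Real.sinh x := Real.sinh_pos_iff.mpr hx0
    have hsx : x < Real.sinh x := Real.self_lt_sinh_iff.mpr hx0
    have hc : 1 ≤ Real.cosh x := Real.one_le_cosh x
    have hsq := Real.cosh_sq x
    apply div_neg_of_neg_of_pos _ (by positivity)
    have e : (2 * Real.sinh x) * (2 * (x * Real.sinh x)) - (2 * Real.cosh x - 1) *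
        (2 * (1 * Real.sinh x + x * Real.cosh x)) =
        2 * (-2 * x - 2 * Real.cosh x * Real.sinh x + Real.sinh x + x * Real.cosh x) := by
      linear_combination (-4 * x) * hsq
    rw [e]
    nlinarith [mul_nonneg (sub_nonneg.mpr hc) hs.le,
      mul_nonneg (sub_nonneg.mpr hsx.le) (zero_le_one.trans hc)]

lemma aux_eq (l : ℝ) (hl : 0 < l) :
    π + (1 / Real.sinh (π * Real.sqrt l)) / (2 * Real.sqrt l)
        - (Real.cosh (π * Real.sqrt l) / Real.sinh (π * Real.sqrt l)) / Real.sqrt l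
    = π * (1 - (2 * Real.cosh (π * Real.sqrt l) - 1) /
        (2 * ((π * Real.sqrt l) * Real.sinh (π * Real.sqrt l)))) := by
  have h1 : 0 < Real.sqrt l := Real.sqrt_pos.mpr hl
  have hp := Real.pi_pos
  have hs : 0 < Real.sinh (π * Real.sqrt l) := Real.sinh_pos_iff.mpr (by positivity)
  generalize Real.sinh (π * Real.sqrt l) = s at *
  field_simp
  ring

/-- The function `g(λ) = π + cosech(π√λ)/(2√λ) − coth(π√λ)/√λ` is strictly increasing
on `(0, ∞)`, and for `λ > 0` one has `g(λ) = 0` iff `λ = λ*`, where `λ*` is the unique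
positive solution of `cosech(π√λ) + 2π√λ = 2 coth(π√λ)`. -/
theorem stmt4 (lamstar : ℝ) (hpos : 0 < lamstar)
    (hstar : 1 / Real.sinh (π * Real.sqrt lamstar) + 2 * π * Real.sqrt lamstar
      = 2 * (Real.cosh (π * Real.sqrt lamstar) / Real.sinh (π * Real.sqrt lamstar))) :
    StrictMonoOn (fun lam : ℝ =>
      π + (1 / Real.sinh (π * Real.sqrt lam)) / (2 * Real.sqrt lam)
        - (Real.cosh (π * Real.sqrt lam) / Real.sinh (π * Real.sqrt lam)) / Real.sqrt lam)
      (Ioi 0) ∧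
    ∀ lam : ℝ, 0 < lam →
      (π + (1 / Real.sinh (π * Real.sqrt lam)) / (2 * Real.sqrt lam)
        - (Real.cosh (π * Real.sqrt lam) / Real.sinh (π * Real.sqrt lam)) / Real.sqrt lam = 0
        ↔ lam = lamstar) := by
  have hmono : StrictMonoOn (fun lam : ℝ =>
      π + (1 / Real.sinh (π * Real.sqrt lam)) / (2 * Real.sqrt lam)
        - (Real.cosh (π * Real.sqrt lam) / Real.sinh (π * Real.sqrt lam)) / Real.sqrt lam)
      (Ioi 0) := by
    intro a ha b hb hab
    have ha0 : 0 < a := ha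
    have hb0 : 0 < b := hb
    have hp := Real.pi_pos
    have h1 : 0 < Real.sqrt a := Real.sqrt_pos.mpr ha0
    have h2 : 0 < Real.sqrt b := Real.sqrt_pos.mpr hb0
    have h3 : Real.sqrt a < Real.sqrt b := Real.sqrt_lt_sqrt ha0.le hab
    have h4 := aux_anti (mem_Ioi.mpr (mul_pos hp h1)) (mem_Ioi.mpr (mul_pos hp h2))
      (mul_lt_mul_of_pos_left h3 hp)
    dsimp only at h4 ⊢
    rw [aux_eq a ha0, aux_eq b hb0]
    exact mul_lt_mul_of_pos_left (by linarith) hp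
  have hz : π + (1 / Real.sinh (π * Real.sqrt lamstar)) / (2 * Real.sqrt lamstar)
        - (Real.cosh (π * Real.sqrt lamstar) / Real.sinh (π * Real.sqrt lamstar))
          / Real.sqrt lamstar = 0 := by
    have h1 : 0 < Real.sqrt lamstar := Real.sqrt_pos.mpr hpos
    generalize 1 / Real.sinh (π * Real.sqrt lamstar) = u at *
    generalize Real.cosh (π * Real.sqrt lamstar) / Real.sinh (π * Real.sqrt lamstar) = v at *
    field_simp
    linarith
  refine ⟨hmono, fun lam hlam => ⟨fun h => ?_, fun h => ?_⟩⟩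
  · exact hmono.injOn (mem_Ioi.mpr hlam) (mem_Ioi.mpr hpos) (h.trans hz.symm)
  · rw [h]; exact hz
end

section
/- Fix λ > 0 and define h(λ, γ) = β·κ₃ − α·κ₄·cosh(απ/2) as a function of γ ≥ 0. Then h(λ, 0) = 0, and the right derivative of γ ↦ h(λ, γ) at γ = 0 equals π + cosech(π√λ)/(2√λ) − coth(π√λ)/√λ. -/
open Real Set

noncomputable def hFun (lam gam : ℝ) : ℝ :=
  bet gam * kappa3 lam gam
    - alph lam gam * kappa4 lam gam * Real.cosh (alph lam gam * (π / 2))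

theorem aux_mul (g : ℝ → ℝ) (hg : ContinuousWithinAt g (Ici 0) 0) :
    HasDerivWithinAt (fun x : ℝ => x * g x) (g 0) (Ici 0) 0 := by
  rw [hasDerivWithinAt_iff_tendsto_slope]
  have h := hg.tendsto.mono_left (nhdsWithin_mono (0:ℝ) (diff_subset (s := Ici (0:ℝ)) (t := {0})))
  refine h.congr' ?_
  filter_upwards [self_mem_nhdsWithin] with x hx
  have hx0 : x ≠ 0 := fun h => hx.2 (by simp [h])
  simp [slope_def_field, hx0]

theorem sinh_eq_dslope (x : ℝ) : Real.sinh x = x * dslope Real.sinh 0 x := by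
  have := sub_smul_dslope Real.sinh 0 x
  simp at this
  exact this.symm

noncomputable def gAux (lam gam : ℝ) : ℝ :=
  (1 / Real.cosh (bet gam * (π / 2))) *
    ((1 / alph lam gam) * (1 / Real.sinh (alph lam gam * (π / 2)))
      + π * dslope Real.sinh 0 (bet gam * (π / 2)))
    - 2 / alph lam gam * (1 / Real.sinh (alph lam gam * (π / 2)))
      * Real.cosh (alph lam gam * (π / 2))

theorem alph_pos (lam gam : ℝ) (hlam : 0 < lam) (hg : 0 ≤ gam) : 0 < alph lam gam :=
  Real.sqrt_pos.2 (by positivity)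

theorem hFun_eq (lam gam : ℝ) (hlam : 0 < lam) (hg : 0 ≤ gam) :
    hFun lam gam = gam * gAux lam gam := by
  have ha := alph_pos lam gam hlam hg
  have hb : bet gam ^ 2 = 2 * gam := Real.sq_sqrt (by positivity)
  have hs : Real.sinh (alph lam gam * (π / 2)) ≠ 0 :=
    (Real.sinh_pos_iff.2 (by positivity)).ne'
  have hc := (Real.cosh_pos (bet gam * (π / 2))).ne'
  have hgam : gam = bet gam ^ 2 / 2 := by linarith
  unfold hFun kappa3 kappa4 gAux
  rw [sinh_eq_dslope (bet gam * (π / 2))]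
  generalize dslope Real.sinh 0 (bet gam * (π / 2)) = D
  generalize Real.cosh (bet gam * (π / 2)) = C at *
  generalize Real.sinh (alph lam gam * (π / 2)) = S at *
  generalize Real.cosh (alph lam gam * (π / 2)) = T at *
  generalize alph lam gam = a at *
  generalize bet gam = b at *
  subst hgam
  field_simp

theorem gAux_cont (lam : ℝ) (hlam : 0 < lam) : ContinuousAt (gAux lam) 0 := by
  have ha := alph_pos lam 0 hlam le_rfl
  have hs : Real.sinh (alph lam 0 * (π / 2)) ≠ 0 :=
    (Real.sinh_pos_iff.2 (by positivity)).ne'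
  have hc := (Real.cosh_pos (bet 0 * (π / 2))).ne'
  have ca : ContinuousAt (alph lam) 0 := by unfold alph; fun_prop
  have cb : ContinuousAt bet 0 := by unfold bet; fun_prop
  have cS : ContinuousAt (fun g => Real.sinh (alph lam g * (π / 2))) 0 := by fun_prop
  have cT : ContinuousAt (fun g => Real.cosh (alph lam g * (π / 2))) 0 := by fun_prop
  have cC : ContinuousAt (fun g => Real.cosh (bet g * (π / 2))) 0 := by fun_prop
  have cD : ContinuousAt (fun g => dslope Real.sinh 0 (bet g * (π / 2))) 0 := by
    have h1 : ContinuousAt (dslope Real.sinh 0) (bet 0 * (π / 2)) := by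
      have : bet 0 * (π / 2) = 0 := by simp [bet]
      rw [this]
      exact continuousAt_dslope_same.2 Real.differentiable_sinh.differentiableAt
    exact ContinuousAt.comp (f := fun g => bet g * (π / 2)) h1 (by fun_prop)
  exact (((continuousAt_const.div cC hc).mul
    (((continuousAt_const.div ca ha.ne').mul (continuousAt_const.div cS hs)).add
      (continuousAt_const.mul cD))).sub
    (((continuousAt_const.div ca ha.ne').mul (continuousAt_const.div cS hs)).mul cT))

/-- For fixed `λ > 0`, `h(λ, 0) = 0` and the right derivative of `γ ↦ h(λ, γ)` at
`γ = 0` equals `π + cosech(π√λ)/(2√λ) − coth(π√λ)/√λ`. -/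
theorem stmt5 (lam : ℝ) (hlam : 0 < lam) :
    hFun lam 0 = 0 ∧
    HasDerivWithinAt (fun gam : ℝ => hFun lam gam)
      (π + (1 / Real.sinh (π * Real.sqrt lam)) / (2 * Real.sqrt lam)
        - (Real.cosh (π * Real.sqrt lam) / Real.sinh (π * Real.sqrt lam)) / Real.sqrt lam)
      (Ici 0) 0 := by
  have h0 : hFun lam 0 = 0 := by rw [hFun_eq lam 0 hlam le_rfl, zero_mul]
  refine ⟨h0, ?_⟩
  have h := aux_mul (gAux lam) (gAux_cont lam hlam).continuousWithinAt
  have h2 : HasDerivWithinAt (fun gam : ℝ => hFun lam gam) (gAux lam 0) (Ici 0) 0 :=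
    h.congr (fun x hx => hFun_eq lam x hlam hx) (hFun_eq lam 0 hlam le_rfl)
  convert h2 using 1
  have ha : alph lam 0 = 2 * Real.sqrt lam := by
    unfold alph
    rw [show 2 * (2 * lam + 0) = 2 ^ 2 * lam by ring, Real.sqrt_mul (by norm_num),
      Real.sqrt_sq (by norm_num)]
  have hb : bet 0 = 0 := by simp [bet]
  have hp : 2 * Real.sqrt lam * (π / 2) = π * Real.sqrt lam := by ring
  have hq := Real.sqrt_pos.2 hlam
  have hs : Real.sinh (π * Real.sqrt lam) ≠ 0 :=
    (Real.sinh_pos_iff.2 (by positivity)).ne'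
  unfold gAux
  rw [ha, hb, hp]
  simp only [zero_mul, dslope_same, Real.deriv_sinh, Real.cosh_zero]
  field_simp
  ring
end

section
/- For λ > 0, the function h(λ, γ) = β·κ₃ − α·κ₄·cosh(απ/2) is non-negative for every γ ≥ 0 if and only if λ ≥ λ*. -/
open Real Set

noncomputable def KK (c b : ℝ) : ℝ :=
  1 / 2 + √(c + b ^ 2) * Real.sinh (√(c + b ^ 2)) * (Real.sinh b / b)
    - Real.cosh (√(c + b ^ 2)) * Real.cosh b

noncomputable def phi (x : ℝ) : ℝ := 1 / 2 + x * Real.sinh x - Real.cosh x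

lemma phi_hasDeriv (x : ℝ) : HasDerivAt phi (x * Real.cosh x) x := by
  have h := (((hasDerivAt_id x).mul (Real.hasDerivAt_sinh x)).const_add (1 / 2)).sub
    (Real.hasDerivAt_cosh x)
  refine (h.congr_deriv ?_).congr_of_eventuallyEq ?_
  · simp
  · refine Filter.Eventually.of_forall fun y => ?_
    simp [phi]

lemma phi_mono : StrictMonoOn phi (Ici 0) := by
  refine strictMonoOn_of_deriv_pos (convex_Ici 0)
    (fun x _ => (phi_hasDeriv x).continuousAt.continuousWithinAt) ?_
  intro x hx
  rw [interior_Ici] at hx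
  rw [(phi_hasDeriv x).deriv]
  exact mul_pos hx (Real.cosh_pos x)

lemma sinh_le_mul_cosh {b : ℝ} (hb : 0 ≤ b) : Real.sinh b ≤ b * Real.cosh b := by
  have hd : ∀ x : ℝ, HasDerivAt (fun x => x * Real.cosh x - Real.sinh x) (x * Real.sinh x) x := by
    intro x
    have h := ((hasDerivAt_id x).mul (Real.hasDerivAt_cosh x)).sub (Real.hasDerivAt_sinh x)
    refine h.congr_deriv ?_
    simp
  have hm : MonotoneOn (fun x : ℝ => x * Real.cosh x - Real.sinh x) (Ici 0) := by
    refine monotoneOn_of_deriv_nonneg (convex_Ici 0)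
      (fun x _ => (hd x).continuousAt.continuousWithinAt)
      (fun x _ => (hd x).differentiableAt.differentiableWithinAt) ?_
    intro x hx
    rw [interior_Ici] at hx
    rw [(hd x).deriv]
    exact mul_nonneg (le_of_lt hx) (Real.sinh_nonneg_iff.2 (le_of_lt hx))
  have := hm (show (0 : ℝ) ∈ Ici 0 by simp) (show b ∈ Ici 0 from hb) hb
  simp at this
  linarith

lemma KK_hasDeriv {c b : ℝ} (hc : 0 < c) (hb : 0 < b) :
    HasDerivAt (KK c) (Real.sinh (√(c + b ^ 2)) / √(c + b ^ 2) *
      (b * Real.cosh b - Real.sinh b) * (c / b ^ 2)) b := by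
  have hp : 0 < c + b ^ 2 := by positivity
  have ha : HasDerivAt (fun b : ℝ => √(c + b ^ 2)) (b / √(c + b ^ 2)) b := by
    have h := (((hasDerivAt_id b).pow 2).const_add c).sqrt (by simpa using hp.ne')
    refine h.congr_deriv ?_
    simp
    field_simp
  have h1 := (((ha.mul ha.sinh).mul ((Real.hasDerivAt_sinh b).div (hasDerivAt_id b) hb.ne')).const_add
    (1 / 2)).sub (ha.cosh.mul (Real.hasDerivAt_cosh b))
  refine h1.congr_deriv ?_
  have hs : 0 < √(c + b ^ 2) := Real.sqrt_pos.2 hp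
  have hsq : √(c + b ^ 2) ^ 2 = c + b ^ 2 := Real.sq_sqrt hp.le
  simp only [id, Pi.mul_apply, Pi.div_apply]
  generalize √(c + b ^ 2) = a at *
  have hc' : c = a ^ 2 - b ^ 2 := by linarith
  subst hc'
  field_simp
  ring

lemma KK_mono {c : ℝ} (hc : 0 < c) : MonotoneOn (KK c) (Ioi 0) := by
  refine monotoneOn_of_deriv_nonneg (convex_Ioi 0)
      (fun x hx => (KK_hasDeriv hc hx).continuousAt.continuousWithinAt)
      (fun x hx => (KK_hasDeriv hc (by simpa using hx)).differentiableAt.differentiableWithinAt) ?_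
  intro x hx
  rw [interior_Ioi] at hx
  rw [(KK_hasDeriv hc hx).deriv]
  have h1 := sinh_le_mul_cosh (le_of_lt hx)
  have h2 : 0 ≤ Real.sinh (√(c + x ^ 2)) := Real.sinh_nonneg_iff.2 (Real.sqrt_nonneg _)
  have h3 : 0 ≤ x * Real.cosh x - Real.sinh x := by linarith
  positivity

open Filter Topology in
lemma KK_tendsto (c : ℝ) : Tendsto (KK c) (𝓝[>] 0) (𝓝 (phi (√c))) := by
  have h1 : Tendsto (fun b : ℝ => Real.sinh b / b) (𝓝[>] 0) (𝓝 1) := by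
    have h := (Real.hasDerivAt_sinh 0).tendsto_slope
    have h' := h.mono_left (nhdsWithin_mono 0 (show Ioi (0 : ℝ) ⊆ {0}ᶜ from
      fun x hx => ne_of_gt hx))
    rw [Real.cosh_zero] at h'
    refine h'.congr fun x => ?_
    simp [slope_def_field]
  have h2 : Tendsto (fun b : ℝ => √(c + b ^ 2) * Real.sinh (√(c + b ^ 2))) (𝓝[>] 0)
      (𝓝 (√c * Real.sinh (√c))) := by
    have : Continuous (fun b : ℝ => √(c + b ^ 2) * Real.sinh (√(c + b ^ 2))) := by fun_prop
    have h := this.tendsto 0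
    simp only [ne_eq, OfNat.ofNat_ne_zero, not_false_eq_true, zero_pow, add_zero] at h
    exact h.mono_left nhdsWithin_le_nhds
  have h3 : Tendsto (fun b : ℝ => Real.cosh (√(c + b ^ 2)) * Real.cosh b) (𝓝[>] 0)
      (𝓝 (Real.cosh (√c))) := by
    have : Continuous (fun b : ℝ => Real.cosh (√(c + b ^ 2)) * Real.cosh b) := by fun_prop
    have h := this.tendsto 0
    simp only [ne_eq, OfNat.ofNat_ne_zero, not_false_eq_true, zero_pow, add_zero,
      Real.cosh_zero, mul_one] at h
    exact h.mono_left nhdsWithin_le_nhds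
  have h := ((h2.mul h1).const_add (1 / 2)).sub h3
  rw [mul_one] at h
  exact h

open Filter Topology in
lemma KK_iff {c : ℝ} (hc : 0 < c) : (∀ b : ℝ, 0 < b → 0 ≤ KK c b) ↔ 0 ≤ phi (√c) := by
  constructor
  · intro h
    refine ge_of_tendsto (KK_tendsto c) ?_
    filter_upwards [self_mem_nhdsWithin] with b hb using h b hb
  · intro h b hb
    refine h.trans (le_of_tendsto (KK_tendsto c) ?_)
    filter_upwards [Ioo_mem_nhdsGT hb] with x hx
    exact KK_mono hc hx.1 hb hx.2.le

lemma hFun_eq_s6 {lam gam : ℝ} (hl : 0 < lam) (hg : 0 < gam) :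
    ∃ r : ℝ, 0 < r ∧ hFun lam gam = r * KK ((π * √lam) ^ 2) (bet gam * (π / 2)) := by
  have hpi := Real.pi_pos
  have hb : 0 < bet gam := Real.sqrt_pos.2 (by positivity)
  have ha : 0 < alph lam gam := Real.sqrt_pos.2 (by positivity)
  have hb2 : bet gam ^ 2 = 2 * gam := Real.sq_sqrt (by positivity)
  have ha2 : alph lam gam ^ 2 = 2 * (2 * lam + gam) := Real.sq_sqrt (by positivity)
  have hs : √((π * √lam) ^ 2 + (bet gam * (π / 2)) ^ 2) = alph lam gam * (π / 2) := by
    rw [Real.sqrt_eq_iff_mul_self_eq (by positivity) (by positivity)]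
    rw [mul_pow, mul_pow, hb2, Real.sq_sqrt hl.le]
    linear_combination -((π / 2) ^ 2) * ha2
  have hsh : 0 < Real.sinh (alph lam gam * (π / 2)) := Real.sinh_pos_iff.2 (by positivity)
  have hch : 0 < Real.cosh (bet gam * (π / 2)) := Real.cosh_pos _
  refine ⟨bet gam * (bet gam / alph lam gam) /
    (Real.sinh (alph lam gam * (π / 2)) * Real.cosh (bet gam * (π / 2))), by positivity, ?_⟩
  unfold hFun KK kappa3 kappa4
  rw [hs]
  field_simp

theorem stmt6 (lamstar : ℝ) (hpos : 0 < lamstar)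
    (hstar : 1 / Real.sinh (π * Real.sqrt lamstar) + 2 * π * Real.sqrt lamstar
      = 2 * (Real.cosh (π * Real.sqrt lamstar) / Real.sinh (π * Real.sqrt lamstar)))
    (lam : ℝ) (hlam : 0 < lam) :
    (∀ gam : ℝ, 0 ≤ gam → 0 ≤ hFun lam gam) ↔ lamstar ≤ lam := by
  have hpi := Real.pi_pos
  have hsl : 0 < √lam := Real.sqrt_pos.2 hlam
  have hss : 0 < √lamstar := Real.sqrt_pos.2 hpos
  have hc : 0 < (π * √lam) ^ 2 := by positivity
  have h0 : phi (π * √lamstar) = 0 := by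
    have hsh : 0 < Real.sinh (π * √lamstar) := Real.sinh_pos_iff.2 (by positivity)
    field_simp at hstar
    unfold phi
    linarith
  have hphi : 0 ≤ phi (π * √lam) ↔ lamstar ≤ lam := by
    rw [← h0, phi_mono.le_iff_le (show π * √lamstar ∈ Ici 0 from by simp; positivity)
      (show π * √lam ∈ Ici 0 from by simp; positivity), mul_le_mul_iff_right₀ hpi,
      Real.sqrt_le_sqrt_iff hlam.le]
  have hk := KK_iff hc
  rw [Real.sqrt_sq (by positivity)] at hk
  rw [← hphi, ← hk]
  constructor
  · intro h b hb
    have hg : 0 < 2 * b ^ 2 / π ^ 2 := by positivity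
    obtain ⟨r, hr, he⟩ := hFun_eq_s6 hlam hg
    have hbb : bet (2 * b ^ 2 / π ^ 2) * (π / 2) = b := by
      have : bet (2 * b ^ 2 / π ^ 2) = 2 * b / π := by
        unfold bet
        rw [Real.sqrt_eq_iff_mul_self_eq (by positivity) (by positivity)]
        field_simp
        try ring
      rw [this]
      field_simp
    have := h _ hg.le
    rw [he, hbb] at this
    exact nonneg_of_mul_nonneg_right this hr
  · intro h gam hg
    rcases hg.eq_or_lt with rfl | hg
    · simp [hFun, kappa4, bet]
    · obtain ⟨r, hr, he⟩ := hFun_eq_s6 hlam hg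
      rw [he]
      refine mul_nonneg hr.le (h _ ?_)
      have hb : 0 < bet gam := Real.sqrt_pos.2 (by positivity)
      positivity
end

section
/- For every λ with 0 < λ < λ*, there exist γ₁ > 0 and γ₂ > 0 such that h(λ, γ₁) < 0 and h(λ, γ₂) > 0. -/
open Real Set

lemma aux_G_mono : StrictMonoOn (fun x : ℝ => 1 + 2 * x * Real.sinh x - 2 * Real.cosh x) (Ici 0) := by
  apply strictMonoOn_of_deriv_pos (convex_Ici 0)
  · fun_prop
  · intro x hx
    rw [interior_Ici] at hx
    have hx' : (0:ℝ) < x := hx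
    have h : HasDerivAt (fun x : ℝ => 1 + 2 * x * Real.sinh x - 2 * Real.cosh x)
        ((2 * 1) * Real.sinh x + 2 * x * Real.cosh x - 2 * Real.sinh x) x :=
      ((((hasDerivAt_id x).const_mul 2).mul (Real.hasDerivAt_sinh x)).const_add 1).sub
        ((Real.hasDerivAt_cosh x).const_mul 2)
    rw [h.deriv]
    have := Real.cosh_pos x
    have : 0 < x * Real.cosh x := by positivity
    linarith

lemma aux_sinh_le {x : ℝ} (hx : 0 ≤ x) : Real.sinh x ≤ x * Real.cosh x := by
  have hm : MonotoneOn (fun x : ℝ => x * Real.cosh x - Real.sinh x) (Ici 0) := by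
    apply monotoneOn_of_deriv_nonneg (convex_Ici 0)
    · fun_prop
    · fun_prop
    · intro x hx
      rw [interior_Ici] at hx
      have hx' : (0:ℝ) < x := hx
      have h : HasDerivAt (fun x : ℝ => x * Real.cosh x - Real.sinh x)
          (1 * Real.cosh x + x * Real.sinh x - Real.cosh x) x :=
        ((hasDerivAt_id x).mul (Real.hasDerivAt_cosh x)).sub (Real.hasDerivAt_sinh x)
      rw [h.deriv]
      have := Real.sinh_pos_iff.2 hx'
      have : 0 < x * Real.sinh x := by positivity
      linarith
  have := hm (mem_Ici.2 le_rfl) (mem_Ici.2 hx) hx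
  simp at this
  linarith

lemma aux_cosh_ge {y : ℝ} (hy : 0 ≤ y) : 1 + y ^ 2 / 2 ≤ Real.cosh y := by
  have h1 : Real.cosh y = 1 + 2 * Real.sinh (y / 2) ^ 2 := by
    have := Real.cosh_two_mul (y / 2)
    rw [Real.cosh_sq, show 2 * (y / 2) = y by ring] at this
    linarith
  have h2 : y / 2 ≤ Real.sinh (y / 2) := Real.self_le_sinh_iff.2 (by linarith)
  rw [h1]
  nlinarith

lemma aux_h {lam gam : ℝ} (hl : 0 < lam) (hg : 0 < gam) :
    hFun lam gam = bet gam / (alph lam gam * Real.cosh (bet gam * (π / 2)) * Real.sinh (alph lam gam * (π / 2)))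
      * (bet gam / 2 + alph lam gam * Real.sinh (bet gam * (π / 2)) * Real.sinh (alph lam gam * (π / 2))
        - bet gam * Real.cosh (alph lam gam * (π / 2)) * Real.cosh (bet gam * (π / 2))) := by
  have ha : 0 < alph lam gam := Real.sqrt_pos.2 (by linarith)
  have hs : 0 < Real.sinh (alph lam gam * (π / 2)) := Real.sinh_pos_iff.2 (by positivity)
  have hc := Real.cosh_pos (bet gam * (π / 2))
  unfold hFun kappa3 kappa4
  field_simp

/-- For every `0 < λ < λ*`, there exist `γ₁ > 0` and `γ₂ > 0` with `h(λ, γ₁) < 0`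
and `h(λ, γ₂) > 0`, where `λ*` is the unique positive solution of
`cosech(π√λ) + 2π√λ = 2 coth(π√λ)`. -/
theorem stmt7 (lamstar : ℝ) (hpos : 0 < lamstar)
    (hstar : 1 / Real.sinh (π * Real.sqrt lamstar) + 2 * π * Real.sqrt lamstar
      = 2 * (Real.cosh (π * Real.sqrt lamstar) / Real.sinh (π * Real.sqrt lamstar)))
    (lam : ℝ) (hlam : 0 < lam) (hlt : lam < lamstar) :
    (∃ gam₁ : ℝ, 0 < gam₁ ∧ hFun lam gam₁ < 0) ∧
    (∃ gam₂ : ℝ, 0 < gam₂ ∧ 0 < hFun lam gam₂) := by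
  have hpi := Real.pi_gt_three
  constructor
  · refine ⟨lamstar - lam, by linarith, ?_⟩
    have hg : 0 < lamstar - lam := by linarith
    rw [aux_h hlam hg]
    have ha : 0 < alph lam (lamstar - lam) := Real.sqrt_pos.2 (by linarith)
    have hb : 0 < bet (lamstar - lam) := Real.sqrt_pos.2 (by linarith)
    have halt : alph lam (lamstar - lam) * (π / 2) < π * √lamstar := by
      have : alph lam (lamstar - lam) < 2 * √lamstar := by
        unfold alph
        rw [Real.sqrt_lt' (by positivity), mul_pow, Real.sq_sqrt hpos.le]
        linarith
      nlinarith
    generalize alph lam (lamstar - lam) = a at *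
    generalize bet (lamstar - lam) = b at *
    have hx : 0 < a * (π / 2) := by positivity
    have hG := aux_G_mono (mem_Ici.2 hx.le) (mem_Ici.2 (hx.trans halt).le) halt
    have hs := Real.sinh_pos_iff.2 hx
    have hss := Real.sinh_pos_iff.2 (hx.trans halt)
    have hC := Real.cosh_pos (b * (π / 2))
    have hC1 := Real.one_le_cosh (b * (π / 2))
    have hS := aux_sinh_le (x := b * (π / 2)) (by positivity)
    field_simp at hstar
    simp only at hG
    have hG0 : 1 + 2 * (a * (π / 2)) * Real.sinh (a * (π / 2)) - 2 * Real.cosh (a * (π / 2)) < 0 := by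
      have : 1 + 2 * (π * √lamstar) * Real.sinh (π * √lamstar) - 2 * Real.cosh (π * √lamstar) = 0 := by
        linarith
      linarith
    apply mul_neg_of_pos_of_neg (by positivity)
    have h1 : a * Real.sinh (b * (π / 2)) * Real.sinh (a * (π / 2)) ≤
        a * (b * (π / 2) * Real.cosh (b * (π / 2))) * Real.sinh (a * (π / 2)) := by gcongr
    have h2 : b / 2 ≤ b / 2 * Real.cosh (b * (π / 2)) := le_mul_of_one_le_right (by positivity) hC1
    have h3 := mul_neg_of_pos_of_neg (mul_pos (half_pos hb) hC) hG0
    nlinarith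
  · have hg : 0 < (1 + 1 / lam) / 2 := by positivity
    refine ⟨(1 + 1 / lam) / 2, hg, ?_⟩
    rw [aux_h hlam hg]
    have ha : 0 < alph lam ((1 + 1 / lam) / 2) := Real.sqrt_pos.2 (by linarith)
    have hb : 0 < bet ((1 + 1 / lam) / 2) := Real.sqrt_pos.2 (by linarith)
    have hb2 : bet ((1 + 1 / lam) / 2) ^ 2 = 1 + 1 / lam := by
      unfold bet; rw [Real.sq_sqrt (by linarith)]; ring
    have ha2 : alph lam ((1 + 1 / lam) / 2) ^ 2 = bet ((1 + 1 / lam) / 2) ^ 2 + 4 * lam := by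
      rw [hb2]
      unfold alph; rw [Real.sq_sqrt (by linarith)]; ring
    generalize alph lam ((1 + 1 / lam) / 2) = a at *
    generalize bet ((1 + 1 / lam) / 2) = b at *
    have hab : b < a := by nlinarith
    have hs := Real.sinh_pos_iff.2 (show 0 < a * (π / 2) by positivity)
    have hS := Real.sinh_pos_iff.2 (show 0 < b * (π / 2) by positivity)
    have hc := Real.cosh_pos (a * (π / 2))
    have hC := Real.cosh_pos (b * (π / 2))
    have hd : 0 < Real.sinh (a * (π / 2) - b * (π / 2)) := Real.sinh_pos_iff.2 (by nlinarith)
    rw [Real.sinh_sub] at hd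
    have hge := aux_cosh_ge (y := b * (π / 2)) (by positivity)
    have hSC := Real.cosh_sq (b * (π / 2))
    generalize Real.sinh (a * (π / 2)) = s at *
    generalize Real.cosh (a * (π / 2)) = c at *
    generalize Real.sinh (b * (π / 2)) = S at *
    generalize Real.cosh (b * (π / 2)) = C at *
    have hC1 : 1 + b ^ 2 ≤ C := by
      have : (2:ℝ) ≤ (π / 2) ^ 2 := by nlinarith
      nlinarith [mul_le_mul_of_nonneg_left this (sq_nonneg b)]
    have hC2 : (1 + b ^ 2) ^ 2 ≤ C ^ 2 := by gcongr
    have hlb : lam * b ^ 2 = lam + 1 := by rw [hb2]; field_simp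
    have hb1 : 1 ≤ b ^ 2 := by rw [hb2]; have : 0 < 1 / lam := by positivity
                               linarith
    have hk : 2 * (b ^ 2 + 4 * lam) ≤ 4 * lam * C ^ 2 := by
      have h := mul_le_mul_of_nonneg_left hC2 (show 0 ≤ 4 * lam by positivity)
      have e : 4 * lam * (1 + b ^ 2) ^ 2 = 4 * lam + 8 * (lam * b ^ 2) + 4 * (lam * b ^ 2) * b ^ 2 := by ring
      rw [e, hlb] at h
      nlinarith
    have hkey : b * C ^ 2 ≤ a * S ^ 2 := by
      apply le_of_sq_le_sq _ (by positivity)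
      rw [mul_pow, mul_pow, ha2, show S ^ 2 = C ^ 2 - 1 by linarith]
      nlinarith [mul_le_mul_of_nonneg_right hk (sq_nonneg C)]
    apply mul_pos (by positivity)
    have : b * c * C ≤ a * S * s := by
      apply le_of_mul_le_mul_right _ hC
      have h1 := mul_le_mul_of_nonneg_left hkey hc.le
      have h2 := mul_pos (mul_pos ha hS) hd
      nlinarith
    linarith
end

section
/- Let λ > 0 and γ ≥ 0. The function w_S is continuous on [0, π] and twice differentiable on (0, π); it satisfies w_S(0) = 1, (1/2)·w_S''(x) = γ·w_S(x) for all x ∈ (0, π/2), (1/2)·w_S''(x) + 2λ·(w_S(π−x) − w_S(x)) = γ·w_S(x) for all x ∈ (π/2, π), and the boundary relation 2λ·(w_S(0) − w_S(π)) = γ·w_S(π), i.e. w_S(π) = 2λ/(2λ+γ). -/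
open Real Set

theorem glue_deriv (f g f' g' : ℝ → ℝ) (m : ℝ) (hf : ∀ x, HasDerivAt f (f' x) x)
    (hg : ∀ x, HasDerivAt g (g' x) x) (h0 : f m = g m) (h1 : f' m = g' m) (x : ℝ) :
    HasDerivAt (fun y => if y ≤ m then f y else g y) (if x ≤ m then f' x else g' x) x := by
  rcases lt_trichotomy x m with h | h | h
  · rw [if_pos h.le]
    refine (hf x).congr_of_eventuallyEq ?_
    filter_upwards [Iio_mem_nhds h] with y hy
    exact if_pos (le_of_lt hy)
  · subst h
    rw [if_pos le_rfl]
    have hl : HasDerivWithinAt (fun y => if y ≤ x then f y else g y) (f' x) (Iic x) x :=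
      (hf x).hasDerivWithinAt.congr (fun y hy => if_pos hy) (if_pos le_rfl)
    have hr : HasDerivWithinAt (fun y => if y ≤ x then f y else g y) (f' x) (Ici x) x := by
      rw [h1]
      refine (hg x).hasDerivWithinAt.congr (fun y hy => ?_) ?_
      · by_cases hyx : y ≤ x
        · have : y = x := le_antisymm hyx hy
          subst this
          simp [h0]
        · simp [hyx]
      · simp [h0]
    have := hl.union hr
    rwa [Iic_union_Ici, hasDerivWithinAt_univ] at this
  · rw [if_neg (not_le.2 h)]
    refine (hg x).congr_of_eventuallyEq ?_
    filter_upwards [Ioi_mem_nhds h] with y hy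
    exact if_neg (not_le.2 hy)


/-- For `λ > 0` and `γ ≥ 0`: `w_S` is continuous on `[0, π]` and twice differentiable on
`(0, π)`; `w_S(0) = 1`; `(1/2) w_S'' = γ w_S` on `(0, π/2)`;
`(1/2) w_S''(x) + 2λ (w_S(π−x) − w_S(x)) = γ w_S(x)` on `(π/2, π)`; and
`2λ (w_S(0) − w_S(π)) = γ w_S(π)`, i.e. `w_S(π) = 2λ/(2λ+γ)`. -/
theorem stmt9 (lam gam : ℝ) (hlam : 0 < lam) (hgam : 0 ≤ gam) :
    ContinuousOn (wS lam gam) (Icc 0 π) ∧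
    (∀ x ∈ Ioo (0 : ℝ) π,
      DifferentiableAt ℝ (wS lam gam) x ∧ DifferentiableAt ℝ (deriv (wS lam gam)) x) ∧
    wS lam gam 0 = 1 ∧
    (∀ x ∈ Ioo (0 : ℝ) (π / 2),
      (1 / 2) * deriv (deriv (wS lam gam)) x = gam * wS lam gam x) ∧
    (∀ x ∈ Ioo (π / 2) π,
      (1 / 2) * deriv (deriv (wS lam gam)) x
        + 2 * lam * (wS lam gam (π - x) - wS lam gam x) = gam * wS lam gam x) ∧
    2 * lam * (wS lam gam 0 - wS lam gam π) = gam * wS lam gam π ∧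
    wS lam gam π = 2 * lam / (2 * lam + gam) := by
  have hα2 : alph lam gam ^ 2 = 2 * (2 * lam + gam) := Real.sq_sqrt (by positivity)
  have hβ2 : bet gam ^ 2 = 2 * gam := Real.sq_sqrt (by positivity)
  have hα : 0 < alph lam gam := Real.sqrt_pos.2 (by positivity)
  have hs : 0 < Real.sinh (alph lam gam * (π / 2)) := Real.sinh_pos_iff.2 (by positivity)
  have hc : 0 < Real.cosh (bet gam * (π / 2)) := Real.cosh_pos _
  have hk3 : kappa3 lam gam * Real.cosh (bet gam * (π / 2)) =
      bet gam / (2 * alph lam gam) * (1 / Real.sinh (alph lam gam * (π / 2)))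
      + Real.sinh (bet gam * (π / 2)) := by
    unfold kappa3
    field_simp
  have hk4 : kappa4 lam gam * alph lam gam =
      2 * bet gam * (bet gam / (2 * alph lam gam) * (1 / Real.sinh (alph lam gam * (π / 2)))) := by
    unfold kappa4
    field_simp
  have hk4s : kappa4 lam gam * Real.sinh (alph lam gam * (π / 2)) * (2 * lam + gam) = gam := by
    have h : kappa4 lam gam * Real.sinh (alph lam gam * (π / 2)) * alph lam gam ^ 2
        = bet gam ^ 2 := by
      unfold kappa4
      field_simp
    rw [hα2, hβ2] at h
    linarith
  have hw : wS lam gam = fun x => if x ≤ π / 2 then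
    Real.cosh (bet gam * x) - kappa3 lam gam * Real.sinh (bet gam * x)
  else
    (Real.cosh (bet gam * (π - x)) - kappa3 lam gam * Real.sinh (bet gam * (π - x)))
      - kappa4 lam gam * Real.sinh (alph lam gam * (x - π / 2)) := rfl
  generalize alph lam gam = a at *
  generalize bet gam = b at *
  generalize kappa3 lam gam = k at *
  generalize kappa4 lam gam = l at *
  have e1 : π - π / 2 = π / 2 := by ring
  have d1 : ∀ x : ℝ, HasDerivAt (fun x : ℝ => b * x) b x := fun x => by
    simpa using (hasDerivAt_id x).const_mul b
  have d2 : ∀ x : ℝ, HasDerivAt (fun x : ℝ => b * (π - x)) (-b) x := fun x => by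
    simpa using ((hasDerivAt_id x).const_sub π).const_mul b
  have d3 : ∀ x : ℝ, HasDerivAt (fun x : ℝ => a * (x - π / 2)) a x := fun x => by
    simpa using ((hasDerivAt_id x).sub_const (π / 2)).const_mul a
  have D1 : ∀ x, HasDerivAt (wS lam gam) (if x ≤ π / 2 then
      Real.sinh (b * x) * b - k * (Real.cosh (b * x) * b)
      else Real.sinh (b * (π - x)) * (-b) - k * (Real.cosh (b * (π - x)) * (-b))
        - l * (Real.cosh (a * (x - π / 2)) * a)) x := by
    rw [hw]
    refine glue_deriv _ _ (fun x => Real.sinh (b * x) * b - k * (Real.cosh (b * x) * b))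
      (fun x => Real.sinh (b * (π - x)) * (-b) - k * (Real.cosh (b * (π - x)) * (-b))
        - l * (Real.cosh (a * (x - π / 2)) * a)) _
      (fun x => (d1 x).cosh.sub ((d1 x).sinh.const_mul k))
      (fun x => ((d2 x).cosh.sub ((d2 x).sinh.const_mul k)).sub ((d3 x).sinh.const_mul l)) ?_ ?_
    · simp [e1]
    · simp only [e1, sub_self, mul_zero, Real.cosh_zero]
      linear_combination (-2 * b) * hk3 + hk4
  have hd : deriv (wS lam gam) = _ := funext fun x => (D1 x).deriv
  have D2 : ∀ x, HasDerivAt (deriv (wS lam gam)) (if x ≤ π / 2 then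
      Real.cosh (b * x) * b * b - k * (Real.sinh (b * x) * b * b)
      else Real.cosh (b * (π - x)) * (-b) * (-b) - k * (Real.sinh (b * (π - x)) * (-b) * (-b))
        - l * (Real.sinh (a * (x - π / 2)) * a * a)) x := by
    rw [hd]
    refine glue_deriv _ _ (fun x => Real.cosh (b * x) * b * b - k * (Real.sinh (b * x) * b * b))
      (fun x => Real.cosh (b * (π - x)) * (-b) * (-b) - k * (Real.sinh (b * (π - x)) * (-b) * (-b))
        - l * (Real.sinh (a * (x - π / 2)) * a * a)) _
      (fun x => ((d1 x).sinh.mul_const b).sub (((d1 x).cosh.mul_const b).const_mul k))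
      (fun x => (((d2 x).sinh.mul_const (-b)).sub (((d2 x).cosh.mul_const (-b)).const_mul k)).sub
        (((d3 x).cosh.mul_const a).const_mul l)) ?_ ?_
    · simp only [e1, sub_self, mul_zero, Real.cosh_zero]
      linear_combination (-2 * b) * hk3 + hk4
    · simp [e1]
  have hπ := Real.pi_pos
  have w0 : wS lam gam 0 = 1 := by
    rw [hw]
    have : (0:ℝ) ≤ π / 2 := by positivity
    simp only [this, if_true, mul_zero, Real.cosh_zero, Real.sinh_zero, sub_zero]
  have wπ : wS lam gam π = 1 - l * Real.sinh (a * (π / 2)) := by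
    rw [hw]
    have : ¬ (π ≤ π / 2) := by linarith
    simp [this, e1]
  refine ⟨fun x _ => (D1 x).continuousAt.continuousWithinAt,
    fun x _ => ⟨(D1 x).differentiableAt, (D2 x).differentiableAt⟩, w0, ?_, ?_, ?_, ?_⟩
  · intro x hx
    rw [(D2 x).deriv, hw]
    simp only [hx.2.le, if_true]
    linear_combination (1 / 2) * (Real.cosh (b * x) - k * Real.sinh (b * x)) * hβ2
  · intro x hx
    have h1 : ¬ (x ≤ π / 2) := not_le.2 hx.1
    have h2 : π - x ≤ π / 2 := by linarith [hx.1]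
    rw [(D2 x).deriv, hw]
    simp only [h1, h2, if_true, if_false]
    linear_combination (1 / 2) * (Real.cosh (b * (π - x)) - k * Real.sinh (b * (π - x))) * hβ2
      - (1 / 2) * l * Real.sinh (a * (x - π / 2)) * hα2
  · rw [w0, wπ]
    linear_combination hk4s
  · have : 0 < 2 * lam + gam := by positivity
    rw [wπ, eq_div_iff this.ne']
    linear_combination -hk4s
end

section
/- Let λ > 0 and set C = C_S(λ). The function v_C is continuous on [0, π] and twice differentiable on (0, π); it satisfies v_C(0) = 0, (1/2)·v_C''(x) = −1 for all x ∈ (0, π/2), (1/2)·v_C''(x) + 2λ·(v_C(π−x) − v_C(x)) = −1 for all x ∈ (π/2, π), and the boundary relation 1 + 2λ·(v_C(0) − v_C(π)) = 0, i.e. v_C(π) = 1/(2λ). -/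
open Real Set

noncomputable def CS (lam : ℝ) : ℝ :=
  (1 / Real.sinh (π * Real.sqrt lam)) / (2 * Real.sqrt lam)

noncomputable def vFun (lam C : ℝ) (x : ℝ) : ℝ :=
  if x ≤ π / 2 then x * (π - x) + C * x
  else x * (π - x) + C * (π - x)
    + C * Real.sinh (Real.sqrt lam * (2 * x - π)) / Real.sqrt lam

theorem glue_aux (f g f' g' : ℝ → ℝ) (a : ℝ) (hf : ∀ x, HasDerivAt f (f' x) x)
    (hg : ∀ x, HasDerivAt g (g' x) x) (h0 : f a = g a) (h1 : f' a = g' a) (x : ℝ) :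
    HasDerivAt (fun y => if y ≤ a then f y else g y) (if x ≤ a then f' x else g' x) x := by
  rcases lt_trichotomy x a with h | h | h
  · rw [if_pos h.le]
    refine (hf x).congr_of_eventuallyEq ?_
    filter_upwards [Iio_mem_nhds h] with y hy
    exact if_pos (le_of_lt hy)
  · subst h
    rw [if_pos le_rfl]
    have hA : HasDerivWithinAt (fun y => if y ≤ x then f y else g y) (f' x) (Iic x) x :=
      (hf x).hasDerivWithinAt.congr (fun y hy => if_pos hy) (if_pos le_rfl)
    have hB : HasDerivWithinAt (fun y => if y ≤ x then f y else g y) (f' x) (Ici x) x := by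
      rw [h1]
      refine (hg x).hasDerivWithinAt.congr (fun y hy => ?_) ?_
      · rcases eq_or_lt_of_le (show x ≤ y from hy) with e | e
        · subst e; simp [h0]
        · exact if_neg (not_le.mpr e)
      · simp [h0]
    have := hA.union hB
    rwa [Iic_union_Ici, hasDerivWithinAt_univ] at this
  · rw [if_neg (not_le.mpr h)]
    refine (hg x).congr_of_eventuallyEq ?_
    filter_upwards [Ioi_mem_nhds h] with y hy
    exact if_neg (not_le.mpr hy)

theorem vFun_d1 (lam C : ℝ) (hlam : 0 < lam) (x : ℝ) :
    HasDerivAt (vFun lam C) (if x ≤ π / 2 then π - 2 * x + C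
      else π - 2 * x - C + 2 * C * Real.cosh (Real.sqrt lam * (2 * x - π))) x := by
  have hs : Real.sqrt lam ≠ 0 := (Real.sqrt_pos.mpr hlam).ne'
  refine glue_aux (fun x => x * (π - x) + C * x)
    (fun x => x * (π - x) + C * (π - x) + C * Real.sinh (Real.sqrt lam * (2 * x - π)) / Real.sqrt lam)
    (fun x => π - 2 * x + C)
    (fun x => π - 2 * x - C + 2 * C * Real.cosh (Real.sqrt lam * (2 * x - π))) (π / 2) ?_ ?_ ?_ ?_ x
  · intro x
    have h := ((hasDerivAt_id x).mul ((hasDerivAt_id x).const_sub π)).add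
      ((hasDerivAt_id x).const_mul C)
    refine h.congr_deriv ?_
    simp; ring
  · intro x
    have h := (((hasDerivAt_id x).mul ((hasDerivAt_id x).const_sub π)).add
      (((hasDerivAt_id x).const_sub π).const_mul C)).add
      ((((((hasDerivAt_id x).const_mul 2).sub_const π).const_mul (Real.sqrt lam)).sinh.const_mul C).div_const (Real.sqrt lam))
    refine h.congr_deriv ?_
    simp; field_simp; ring
  · have : 2 * (π / 2) - π = 0 := by ring
    simp only [this, mul_zero, Real.sinh_zero, zero_div]; ring
  · have : 2 * (π / 2) - π = 0 := by ring
    simp only [this]; simp; ring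

theorem vFun_d2 (lam C : ℝ) (x : ℝ) :
    HasDerivAt (fun x => if x ≤ π / 2 then π - 2 * x + C
      else π - 2 * x - C + 2 * C * Real.cosh (Real.sqrt lam * (2 * x - π)))
      (if x ≤ π / 2 then -2
        else -2 + 4 * C * Real.sqrt lam * Real.sinh (Real.sqrt lam * (2 * x - π))) x := by
  refine glue_aux (fun x => π - 2 * x + C)
    (fun x => π - 2 * x - C + 2 * C * Real.cosh (Real.sqrt lam * (2 * x - π)))
    (fun x => -2)
    (fun x => -2 + 4 * C * Real.sqrt lam * Real.sinh (Real.sqrt lam * (2 * x - π))) (π / 2) ?_ ?_ ?_ ?_ x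
  · intro x
    have h := (((hasDerivAt_id x).const_mul 2).const_sub π).add_const C
    refine h.congr_deriv ?_
    simp
  · intro x
    have h := ((((hasDerivAt_id x).const_mul 2).const_sub π).sub_const C).add
      (((((hasDerivAt_id x).const_mul 2).sub_const π).const_mul (Real.sqrt lam)).cosh.const_mul (2 * C))
    refine h.congr_deriv ?_
    simp; ring
  · have : 2 * (π / 2) - π = 0 := by ring
    simp only [this]; simp; ring
  · have : 2 * (π / 2) - π = 0 := by ring
    simp only [this]; simp

/-- For `λ > 0` and `C = C_S(λ)`: `v_C` is continuous on `[0, π]` and twice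
differentiable on `(0, π)`; `v_C(0) = 0`; `(1/2) v_C'' = −1` on `(0, π/2)`;
`(1/2) v_C''(x) + 2λ (v_C(π−x) − v_C(x)) = −1` on `(π/2, π)`; and
`1 + 2λ (v_C(0) − v_C(π)) = 0`, i.e. `v_C(π) = 1/(2λ)`. -/
theorem stmt11 (lam : ℝ) (hlam : 0 < lam) :
    ContinuousOn (vFun lam (CS lam)) (Icc 0 π) ∧
    (∀ x ∈ Ioo (0 : ℝ) π,
      DifferentiableAt ℝ (vFun lam (CS lam)) x ∧
        DifferentiableAt ℝ (deriv (vFun lam (CS lam))) x) ∧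
    vFun lam (CS lam) 0 = 0 ∧
    (∀ x ∈ Ioo (0 : ℝ) (π / 2),
      (1 / 2) * deriv (deriv (vFun lam (CS lam))) x = -1) ∧
    (∀ x ∈ Ioo (π / 2) π,
      (1 / 2) * deriv (deriv (vFun lam (CS lam))) x
        + 2 * lam * (vFun lam (CS lam) (π - x) - vFun lam (CS lam) x) = -1) ∧
    1 + 2 * lam * (vFun lam (CS lam) 0 - vFun lam (CS lam) π) = 0 ∧
    vFun lam (CS lam) π = 1 / (2 * lam) := by
  have hd := funext fun x => (vFun_d1 lam (CS lam) hlam x).deriv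
  have hsp := Real.sqrt_pos.mpr hlam
  have hs : Real.sqrt lam ≠ 0 := hsp.ne'
  have hsq : Real.sqrt lam * Real.sqrt lam = lam := Real.mul_self_sqrt hlam.le
  have hpi := Real.pi_pos
  have h0 : vFun lam (CS lam) 0 = 0 := by
    unfold vFun; rw [if_pos (by positivity)]; ring
  have hp : vFun lam (CS lam) π = 1 / (2 * lam) := by
    have hsh : Real.sinh (π * Real.sqrt lam) ≠ 0 :=
      (Real.sinh_pos_iff.mpr (by positivity)).ne'
    unfold vFun; rw [if_neg (by linarith)]
    have e : Real.sqrt lam * (2 * π - π) = π * Real.sqrt lam := by ring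
    rw [e, ← hsq]
    rw [hsq]
    unfold CS
    have e2 : 1 / (2 * lam) = 1 / (2 * (Real.sqrt lam * Real.sqrt lam)) := by rw [hsq]
    rw [e2]
    generalize Real.sinh (π * Real.sqrt lam) = S at *
    generalize Real.sqrt lam = s at *
    field_simp
    ring
  refine ⟨fun x _ => (vFun_d1 lam _ hlam x).continuousAt.continuousWithinAt,
    fun x _ => ⟨(vFun_d1 lam _ hlam x).differentiableAt, ?_⟩, h0, ?_, ?_, ?_, hp⟩
  · rw [hd]; exact (vFun_d2 lam _ x).differentiableAt
  · intro x hx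
    rw [hd, (vFun_d2 lam _ x).deriv, if_pos hx.2.le]; norm_num
  · intro x hx
    have hx1 := hx.1
    rw [hd, (vFun_d2 lam _ x).deriv, if_neg (not_le.mpr hx.1)]
    unfold vFun
    rw [if_pos (by linarith), if_neg (not_le.mpr hx.1)]
    generalize Real.sinh (Real.sqrt lam * (2 * x - π)) = S
    generalize CS lam = C
    have e : lam * (C * S / Real.sqrt lam) = C * S * Real.sqrt lam := by
      field_simp
      linear_combination (-(C * S)) * (Real.sq_sqrt hlam.le)
    linear_combination (-2) * e
  · rw [h0, hp]; field_simp; ring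
end

section
/- Let λ > 0 and set C = C_M(λ). The function v_C is continuous on [0, π] and twice differentiable on (0, π); it satisfies v_C(0) = 0, (1/2)·v_C''(x) = −1 for all x ∈ (0, π/2), (1/2)·v_C''(x) + 2λ·(v_C(π−x) − v_C(x)) = −1 for all x ∈ (π/2, π), and the left derivative of v_C at x = π equals 0. -/
open Real Set

noncomputable def CM (lam : ℝ) : ℝ :=
  π / (2 * Real.cosh (π * Real.sqrt lam) - 1)

theorem glue_hasDerivAt (a : ℝ) (f g f' g' : ℝ → ℝ) (hf : ∀ x, HasDerivAt f (f' x) x)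
    (hg : ∀ x, HasDerivAt g (g' x) x) (h0 : f a = g a) (h1 : f' a = g' a) (x : ℝ) :
    HasDerivAt (fun x => if x ≤ a then f x else g x) (if x ≤ a then f' x else g' x) x := by
  rcases lt_trichotomy x a with h | h | h
  · rw [if_pos h.le]
    refine (hf x).congr_of_eventuallyEq ?_
    filter_upwards [Iio_mem_nhds h] with y hy
    exact if_pos (le_of_lt hy)
  · subst h
    rw [if_pos le_rfl]
    have hl : HasDerivWithinAt (fun y => if y ≤ x then f y else g y) (f' x) (Iic x) x := by
      refine (hf x).hasDerivWithinAt.congr (fun y hy => if_pos hy) (if_pos le_rfl)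
    have hr : HasDerivWithinAt (fun y => if y ≤ x then f y else g y) (f' x) (Ici x) x := by
      rw [h1]
      refine (hg x).hasDerivWithinAt.congr (fun y hy => ?_) ?_
      · rcases eq_or_lt_of_le (show x ≤ y from hy) with h | h
        · subst h; simp [h0]
        · exact if_neg (not_le.2 h)
      · simp [h0]
    have := hl.union hr
    rw [Iic_union_Ici] at this
    exact hasDerivWithinAt_univ.1 this
  · rw [if_neg (not_le.2 h)]
    refine (hg x).congr_of_eventuallyEq ?_
    filter_upwards [Ioi_mem_nhds h] with y hy
    exact if_neg (not_le.2 hy)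

/-- For `λ > 0` and `C = C_M(λ)`: `v_C` is continuous on `[0, π]` and twice
differentiable on `(0, π)`; `v_C(0) = 0`; `(1/2) v_C'' = −1` on `(0, π/2)`;
`(1/2) v_C''(x) + 2λ (v_C(π−x) − v_C(x)) = −1` on `(π/2, π)`; and the left derivative
of `v_C` at `π` equals `0`. -/
theorem stmt12 (lam : ℝ) (hlam : 0 < lam) :
    ContinuousOn (vFun lam (CM lam)) (Icc 0 π) ∧
    (∀ x ∈ Ioo (0 : ℝ) π,
      DifferentiableAt ℝ (vFun lam (CM lam)) x ∧
        DifferentiableAt ℝ (deriv (vFun lam (CM lam))) x) ∧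
    vFun lam (CM lam) 0 = 0 ∧
    (∀ x ∈ Ioo (0 : ℝ) (π / 2),
      (1 / 2) * deriv (deriv (vFun lam (CM lam))) x = -1) ∧
    (∀ x ∈ Ioo (π / 2) π,
      (1 / 2) * deriv (deriv (vFun lam (CM lam))) x
        + 2 * lam * (vFun lam (CM lam) (π - x) - vFun lam (CM lam) x) = -1) ∧
    HasDerivWithinAt (vFun lam (CM lam)) 0 (Iic π) π := by
  have hs : 0 < Real.sqrt lam := Real.sqrt_pos.2 hlam
  have hss : Real.sqrt lam * Real.sqrt lam = lam := Real.mul_self_sqrt hlam.le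
  have hpi := Real.pi_pos
  have hC : CM lam * (2 * Real.cosh (π * Real.sqrt lam) - 1) = π := by
    unfold CM
    have := Real.one_le_cosh (π * Real.sqrt lam)
    exact div_mul_cancel₀ _ (by linarith)
  generalize CM lam = C at hC ⊢
  set s := Real.sqrt lam with hsdef
  have hin : ∀ x : ℝ, HasDerivAt (fun x : ℝ => s * (2 * x - π)) (s * 2) x := fun x => by
    simpa using (((hasDerivAt_id x).const_mul 2).sub_const π).const_mul s
  have hq : ∀ x : ℝ, HasDerivAt (fun x : ℝ => x * (π - x)) (π - 2 * x) x := fun x => by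
    refine ((hasDerivAt_id x).mul ((hasDerivAt_id x).const_sub π)).congr_deriv ?_
    simp only [id]; ring
  have hq' : ∀ x : ℝ, HasDerivAt (fun x : ℝ => π - 2 * x) (-2) x := fun x => by
    simpa using ((hasDerivAt_id x).const_mul 2).const_sub π
  have hz : s * (2 * (π / 2) - π) = 0 := by ring
  have d1 : ∀ x, HasDerivAt (vFun lam C)
      (if x ≤ π / 2 then π - 2 * x + C
        else π - 2 * x - C + 2 * C * Real.cosh (s * (2 * x - π))) x := by
    refine glue_hasDerivAt (π / 2) (fun x => x * (π - x) + C * x)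
      (fun x => x * (π - x) + C * (π - x) + C * Real.sinh (s * (2 * x - π)) / s)
      (fun x => π - 2 * x + C)
      (fun x => π - 2 * x - C + 2 * C * Real.cosh (s * (2 * x - π))) ?_ ?_ ?_ ?_
    · intro x
      refine ((hq x).add ((hasDerivAt_id x).const_mul C)).congr_deriv ?_
      ring
    · intro x
      refine (((hq x).add (((hasDerivAt_id x).const_sub π).const_mul C)).add
        (((hin x).sinh.const_mul C).div_const s)).congr_deriv ?_
      field_simp
      ring
    · simp only [hz, Real.sinh_zero]; ring
    · simp only [hz, Real.cosh_zero]; ring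
  have e1 := funext fun x => (d1 x).deriv
  have d2 : ∀ x, HasDerivAt (deriv (vFun lam C))
      (if x ≤ π / 2 then -2 else -2 + 4 * C * s * Real.sinh (s * (2 * x - π))) x := by
    rw [show deriv (vFun lam C) = _ from e1]
    refine glue_hasDerivAt (π / 2) (fun x => π - 2 * x + C)
      (fun x => π - 2 * x - C + 2 * C * Real.cosh (s * (2 * x - π)))
      (fun x => -2) (fun x => -2 + 4 * C * s * Real.sinh (s * (2 * x - π))) ?_ ?_ ?_ ?_
    · intro x
      exact (hq' x).add_const C
    · intro x
      refine (((hq' x).sub_const C).add ((hin x).cosh.const_mul (2 * C))).congr_deriv ?_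
      ring
    · simp only [hz, Real.cosh_zero]; ring
    · simp only [hz, Real.sinh_zero]; ring
  refine ⟨fun x _ => (d1 x).continuousAt.continuousWithinAt,
    fun x _ => ⟨(d1 x).differentiableAt, (d2 x).differentiableAt⟩, ?_, ?_, ?_, ?_⟩
  · unfold vFun
    rw [if_pos (by linarith)]; ring
  · intro x hx
    rw [(d2 x).deriv, if_pos hx.2.le]; norm_num
  · intro x hx
    have h1 : ¬ x ≤ π / 2 := not_le.2 hx.1
    have h2 : π - x ≤ π / 2 := by linarith [hx.1]
    rw [(d2 x).deriv, if_neg h1]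
    unfold vFun
    rw [if_pos h2, if_neg h1, ← hsdef, ← hss]
    field_simp
    ring
  · refine ((d1 π).congr_deriv ?_).hasDerivWithinAt
    rw [if_neg (by linarith), show s * (2 * π - π) = π * s by ring]
    linarith
end

section
/- For every λ with 0 < λ ≤ λ*, the function v_C with C = C_M(λ) is concave on [0, π]. -/
open Real Set

lemma aux_anti_s13 : AntitoneOn (fun t : ℝ => Real.cosh t - t * Real.sinh t) (Ici 0) := by
  have hd : ∀ t : ℝ, HasDerivAt (fun t : ℝ => Real.cosh t - t * Real.sinh t)
      (-(t * Real.cosh t)) t := by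
    intro t
    have := (Real.hasDerivAt_cosh t).sub ((hasDerivAt_id t).mul (Real.hasDerivAt_sinh t))
    refine this.congr_deriv ?_
    simp
  apply antitoneOn_of_deriv_nonpos (convex_Ici 0)
  · exact fun t _ => (hd t).continuousAt.continuousWithinAt
  · exact fun t _ => (hd t).differentiableAt.differentiableWithinAt
  · intro t ht
    rw [interior_Ici] at ht
    rw [(hd t).deriv]
    have : 0 ≤ t * Real.cosh t := mul_nonneg (le_of_lt ht) (Real.cosh_pos t).le
    linarith

lemma aux_B (s C : ℝ) (hs : 0 < s) (hC : 0 ≤ C) (h : 2 * C * s * Real.sinh (π * s) ≤ 1) :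
    AntitoneOn (fun x : ℝ => π - 2 * x - C + 2 * C * Real.cosh (s * (2 * x - π)))
      (Icc (π / 2) π) := by
  have hd : ∀ x : ℝ, HasDerivAt
      (fun x : ℝ => π - 2 * x - C + 2 * C * Real.cosh (s * (2 * x - π)))
      (-2 + 2 * C * (Real.sinh (s * (2 * x - π)) * (s * 2))) x := by
    intro x
    have h1 : HasDerivAt (fun x : ℝ => 2 * x) 2 x := by
      simpa using (hasDerivAt_id x).const_mul (2 : ℝ)
    have h2 : HasDerivAt (fun x : ℝ => s * (2 * x - π)) (s * 2) x :=
      (h1.sub_const π).const_mul s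
    exact ((h1.const_sub π).sub_const C).add (h2.cosh.const_mul (2 * C))
  apply antitoneOn_of_deriv_nonpos (convex_Icc _ _)
  · exact fun t _ => (hd t).continuousAt.continuousWithinAt
  · exact fun t _ => (hd t).differentiableAt.differentiableWithinAt
  · intro t ht
    rw [interior_Icc] at ht
    rw [(hd t).deriv]
    have h3 : Real.sinh (s * (2 * t - π)) ≤ Real.sinh (π * s) := by
      rw [Real.sinh_le_sinh]
      nlinarith [ht.2]
    have h4 := mul_le_mul_of_nonneg_left h3 (mul_nonneg hC hs.le)
    nlinarith

lemma aux_deriv (lam C : ℝ) (hl : 0 < lam) (x : ℝ) : HasDerivAt (vFun lam C)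
    (if x ≤ π / 2 then π - 2 * x + C
      else π - 2 * x - C + 2 * C * Real.cosh (Real.sqrt lam * (2 * x - π))) x := by
  have hs : Real.sqrt lam ≠ 0 := (Real.sqrt_pos.2 hl).ne'
  set s := Real.sqrt lam with hsd
  have h0 : HasDerivAt (fun x : ℝ => x * (π - x)) (π - 2 * x) x := by
    refine ((hasDerivAt_id x).mul ((hasDerivAt_id x).const_sub π)).congr_deriv ?_
    simp; ring
  have hA : HasDerivAt (fun x : ℝ => x * (π - x) + C * x) (π - 2 * x + C) x := by
    refine (h0.add ((hasDerivAt_id x).const_mul C)).congr_deriv ?_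
    simp
  have hB : HasDerivAt (fun x : ℝ => x * (π - x) + C * (π - x)
      + C * Real.sinh (s * (2 * x - π)) / s)
      (π - 2 * x - C + 2 * C * Real.cosh (s * (2 * x - π))) x := by
    have h1 : HasDerivAt (fun x : ℝ => 2 * x) 2 x := by
      simpa using (hasDerivAt_id x).const_mul (2 : ℝ)
    have h2 : HasDerivAt (fun x : ℝ => s * (2 * x - π)) (s * 2) x :=
      (h1.sub_const π).const_mul s
    refine ((h0.add (((hasDerivAt_id x).const_sub π).const_mul C)).add
      ((h2.sinh.const_mul C).div_const s)).congr_deriv ?_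
    field_simp
    ring
  have eB : ∀ y, π / 2 ≤ y → vFun lam C y = y * (π - y) + C * (π - y)
      + C * Real.sinh (s * (2 * y - π)) / s := by
    intro y hy
    unfold vFun
    split_ifs with h
    · obtain rfl : y = π / 2 := le_antisymm h hy
      have : (2 * (π / 2) - π) = 0 := by ring
      rw [this]; simp; ring_nf; simp
    · rfl
  have eA : ∀ y, y ≤ π / 2 → vFun lam C y = y * (π - y) + C * y := by
    intro y hy
    unfold vFun
    rw [if_pos hy]
  rcases lt_trichotomy x (π / 2) with hx | hx | hx
  · rw [if_pos hx.le]
    refine hA.congr_of_eventuallyEq ?_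
    filter_upwards [Iio_mem_nhds hx] with y hy using eA y (le_of_lt hy)
  · rw [if_pos hx.le]
    have hB' : π - 2 * x - C + 2 * C * Real.cosh (s * (2 * x - π)) = π - 2 * x + C := by
      have : (2 * x - π) = 0 := by rw [hx]; ring
      rw [this]; simp; ring
    rw [hB'] at hB
    have u := (hA.hasDerivWithinAt (s := Iic x)).congr
      (fun y hy => eA y (le_trans hy hx.le)) (eA x hx.le)
    have w := (hB.hasDerivWithinAt (s := Ici x)).congr
      (fun y hy => eB y (le_trans hx.ge hy)) (eB x hx.ge)
    have := u.union w
    rwa [Iic_union_Ici, hasDerivWithinAt_univ] at this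
  · rw [if_neg (not_le.2 hx)]
    refine hB.congr_of_eventuallyEq ?_
    filter_upwards [Ioi_mem_nhds hx] with y hy using eB y (le_of_lt hy)

/-- For every `0 < λ ≤ λ*`, the function `v_C` with `C = C_M(λ)` is concave on `[0, π]`,
where `λ*` is the unique positive solution of `cosech(π√λ) + 2π√λ = 2 coth(π√λ)`. -/
theorem stmt13 (lamstar : ℝ) (hpos : 0 < lamstar)
    (hstar : 1 / Real.sinh (π * Real.sqrt lamstar) + 2 * π * Real.sqrt lamstar
      = 2 * (Real.cosh (π * Real.sqrt lamstar) / Real.sinh (π * Real.sqrt lamstar)))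
    (lam : ℝ) (hlam : 0 < lam) (hle : lam ≤ lamstar) :
    ConcaveOn ℝ (Icc 0 π) (vFun lam (CM lam)) := by
  have hs : 0 < Real.sqrt lam := Real.sqrt_pos.2 hlam
  have hu : 0 < π * Real.sqrt lamstar := mul_pos pi_pos (Real.sqrt_pos.2 hpos)
  have ht : 0 < π * Real.sqrt lam := mul_pos pi_pos hs
  have htu : π * Real.sqrt lam ≤ π * Real.sqrt lamstar :=
    mul_le_mul_of_nonneg_left (Real.sqrt_le_sqrt hle) pi_pos.le
  have hsu : 0 < Real.sinh (π * Real.sqrt lamstar) := Real.sinh_pos_iff.2 hu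
  have key : 2 * (π * Real.sqrt lam) * Real.sinh (π * Real.sqrt lam)
      ≤ 2 * Real.cosh (π * Real.sqrt lam) - 1 := by
    have h1 := aux_anti_s13 (mem_Ici.2 ht.le) (mem_Ici.2 hu.le) htu
    simp only at h1
    have h2 : 1 + 2 * (π * Real.sqrt lamstar) * Real.sinh (π * Real.sqrt lamstar)
        = 2 * Real.cosh (π * Real.sqrt lamstar) := by
      field_simp at hstar
      linarith
    linarith
  have hden : 0 < 2 * Real.cosh (π * Real.sqrt lam) - 1 := by
    linarith [Real.one_le_cosh (π * Real.sqrt lam)]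
  have hC : 0 ≤ CM lam := div_nonneg pi_pos.le hden.le
  have hk : 2 * CM lam * Real.sqrt lam * Real.sinh (π * Real.sqrt lam) ≤ 1 := by
    have : 2 * CM lam * Real.sqrt lam * Real.sinh (π * Real.sqrt lam)
      = (2 * (π * Real.sqrt lam) * Real.sinh (π * Real.sqrt lam))
        / (2 * Real.cosh (π * Real.sqrt lam) - 1) := by
      unfold CM; ring
    rw [this]
    exact (div_le_one hden).2 key
  have hB := aux_B _ _ hs hC hk
  have hd := aux_deriv lam (CM lam) hlam
  have hanti : AntitoneOn (deriv (vFun lam (CM lam))) (interior (Icc 0 π)) := by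
    rw [interior_Icc]
    intro x hx y hy hxy
    rw [(hd x).deriv, (hd y).deriv]
    have hp := pi_pos
    by_cases h1 : y ≤ π / 2
    · rw [if_pos h1, if_pos (hxy.trans h1)]; linarith
    · rw [if_neg h1]
      have h1 := not_le.1 h1
      split_ifs with h2
      · have := hB (show π / 2 ∈ Icc (π / 2) π from ⟨le_rfl, by linarith⟩)
          (show y ∈ Icc (π / 2) π from ⟨h1.le, hy.2.le⟩) h1.le
        simp only at this
        have e : (2 * (π / 2) - π) = 0 := by ring
        rw [e, mul_zero, Real.cosh_zero] at this
        linarith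
      · exact hB ⟨(not_le.1 h2).le, hx.2.le⟩ ⟨h1.le, hy.2.le⟩ hxy
  exact hanti.concaveOn_of_deriv (convex_Icc 0 π)
    (fun x _ => (hd x).continuousAt.continuousWithinAt)
    (fun x _ => (hd x).differentiableAt.differentiableWithinAt)
end

section
/- For λ > 0, one has C_M(λ) < C_S(λ) if and only if λ < λ*, and C_M(λ) = C_S(λ) if and only if λ = λ*. -/
open Real Set

noncomputable def gaux (x : ℝ) : ℝ := 2 * Real.cosh x - 1 - 2 * x * Real.sinh x

lemma gaux_anti : StrictAntiOn gaux (Set.Ici 0) := by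
  have hd : ∀ x, HasDerivAt gaux (-2 * x * Real.cosh x) x := by
    intro x
    have h := (((Real.hasDerivAt_cosh x).const_mul 2).sub_const 1).sub
      (((hasDerivAt_id x).const_mul 2).mul (Real.hasDerivAt_sinh x))
    refine HasDerivAt.congr_deriv h ?_
    simp
  apply strictAntiOn_of_deriv_neg (convex_Ici 0)
  · exact fun x _ => (hd x).continuousAt.continuousWithinAt
  · intro x hx
    rw [interior_Ici] at hx
    have hx : 0 < x := hx
    rw [(hd x).deriv]
    have := mul_pos hx (Real.cosh_pos x)
    linarith

/-- For `λ > 0`, `C_M(λ) < C_S(λ)` iff `λ < λ*`, and `C_M(λ) = C_S(λ)` iff `λ = λ*`,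
where `λ*` is the unique positive solution of `cosech(π√λ) + 2π√λ = 2 coth(π√λ)`. -/
theorem stmt15 (lamstar : ℝ) (hpos : 0 < lamstar)
    (hstar : 1 / Real.sinh (π * Real.sqrt lamstar) + 2 * π * Real.sqrt lamstar
      = 2 * (Real.cosh (π * Real.sqrt lamstar) / Real.sinh (π * Real.sqrt lamstar)))
    (lam : ℝ) (hlam : 0 < lam) :
    (CM lam < CS lam ↔ lam < lamstar) ∧ (CM lam = CS lam ↔ lam = lamstar) := by
  have hp := Real.pi_pos
  have hs := Real.sqrt_pos.2 hlam
  have hx : 0 < π * Real.sqrt lam := mul_pos hp hs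
  have hy : 0 < π * Real.sqrt lamstar := mul_pos hp (Real.sqrt_pos.2 hpos)
  have hsx := Real.sinh_pos_iff.2 hx
  have hsy := Real.sinh_pos_iff.2 hy
  have hc := Real.one_le_cosh (π * Real.sqrt lam)
  have h0 : gaux (π * Real.sqrt lamstar) = 0 := by
    field_simp at hstar
    unfold gaux
    linarith
  have hden : 0 < 2 * Real.cosh (π * Real.sqrt lam) - 1 := by linarith
  have hCS : CS lam = 1 / (Real.sinh (π * Real.sqrt lam) * (2 * Real.sqrt lam)) := by
    unfold CS
    rw [div_div]
  have hden2 : 0 < Real.sinh (π * Real.sqrt lam) * (2 * Real.sqrt lam) := by positivity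
  have key1 : CM lam < CS lam ↔ gaux (π * Real.sqrt lamstar) < gaux (π * Real.sqrt lam) := by
    rw [h0, hCS, CM, div_lt_div_iff₀ hden hden2, gaux]
    constructor <;> intro h <;> linarith
  have key2 : CM lam = CS lam ↔ gaux (π * Real.sqrt lam) = gaux (π * Real.sqrt lamstar) := by
    rw [h0, hCS, CM, div_eq_div_iff hden.ne' hden2.ne', gaux]
    constructor <;> intro h <;> linarith
  rw [key1, key2, gaux_anti.lt_iff_gt hy.le hx.le,
    gaux_anti.injOn.eq_iff hx.le hy.le, mul_lt_mul_iff_right₀ hp,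
    Real.sqrt_lt_sqrt_iff hlam.le, mul_right_inj' hp.ne', Real.sqrt_inj hlam.le hpos.le]
  exact ⟨Iff.rfl, Iff.rfl⟩
end

section
/- For λ > 0, the following are equivalent: (i) λ < λ*; (ii) for every x ∈ (0, π], v_{C_M(λ)}(x) < v_{C_S(λ)}(x). -/
open Real Set

theorem g_anti : StrictAntiOn (fun t : ℝ => 2 * Real.cosh t - 2 * t * Real.sinh t) (Ici 0) := by
  have hd : ∀ t : ℝ, HasDerivAt (fun t : ℝ => 2 * Real.cosh t - 2 * t * Real.sinh t)
      (-(2 * t * Real.cosh t)) t := by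
    intro t
    have h := ((Real.hasDerivAt_cosh t).const_mul 2).sub
      (((hasDerivAt_id t).const_mul 2).mul (Real.hasDerivAt_sinh t))
    refine h.congr_deriv ?_
    simp
  apply strictAntiOn_of_deriv_neg (convex_Ici 0)
  · exact fun t _ => (hd t).continuousAt.continuousWithinAt
  · intro t ht
    rw [interior_Ici] at ht
    rw [(hd t).deriv]
    have h1 : 0 < t := ht
    have h2 := Real.cosh_pos t
    have : 0 < 2 * t * Real.cosh t := by positivity
    linarith

theorem vFun_lt_iff (lam C D x : ℝ) (hlam : 0 < lam) (hx : x ∈ Ioc (0 : ℝ) π) :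
    vFun lam C x < vFun lam D x ↔ C < D := by
  have hs : 0 < Real.sqrt lam := Real.sqrt_pos.2 hlam
  obtain ⟨h0, h1⟩ := hx
  unfold vFun
  split_ifs with h
  · rw [add_lt_add_iff_left]
    exact mul_lt_mul_iff_left₀ h0
  · push Not at h
    have h2 : 0 < Real.sinh (Real.sqrt lam * (2 * x - π)) :=
      Real.sinh_pos_iff.2 (mul_pos hs (by linarith))
    have hw : 0 < (π - x) + Real.sinh (Real.sqrt lam * (2 * x - π)) / Real.sqrt lam :=
      add_pos_of_nonneg_of_pos (by linarith) (div_pos h2 hs)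
    rw [add_assoc, add_assoc, add_lt_add_iff_left, mul_div_assoc, mul_div_assoc, ← mul_add,
      ← mul_add]
    exact mul_lt_mul_iff_left₀ hw

/-- For `λ > 0`: `λ < λ*` iff `v_{C_M(λ)}(x) < v_{C_S(λ)}(x)` for every `x ∈ (0, π]`,
where `λ*` is the unique positive solution of `cosech(π√λ) + 2π√λ = 2 coth(π√λ)`. -/
theorem stmt16 (lamstar : ℝ) (hpos : 0 < lamstar)
    (hstar : 1 / Real.sinh (π * Real.sqrt lamstar) + 2 * π * Real.sqrt lamstar
      = 2 * (Real.cosh (π * Real.sqrt lamstar) / Real.sinh (π * Real.sqrt lamstar)))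
    (lam : ℝ) (hlam : 0 < lam) :
    lam < lamstar ↔ ∀ x ∈ Ioc (0 : ℝ) π, vFun lam (CM lam) x < vFun lam (CS lam) x := by
  have hs : 0 < Real.sqrt lam := Real.sqrt_pos.2 hlam
  have hss : 0 < Real.sqrt lamstar := Real.sqrt_pos.2 hpos
  have hp := Real.pi_pos
  have key : (∀ x ∈ Ioc (0 : ℝ) π, vFun lam (CM lam) x < vFun lam (CS lam) x) ↔
      CM lam < CS lam := by
    constructor
    · intro h
      exact (vFun_lt_iff _ _ _ π hlam ⟨hp, le_rfl⟩).1 (h π ⟨hp, le_rfl⟩)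
    · intro h x hx
      exact (vFun_lt_iff _ _ _ x hlam hx).2 h
  rw [key]
  have ht : 0 < π * Real.sqrt lam := mul_pos hp hs
  have hts : 0 < π * Real.sqrt lamstar := mul_pos hp hss
  have hsh := Real.sinh_pos_iff.2 ht
  have hshs := Real.sinh_pos_iff.2 hts
  have hc := Real.one_le_cosh (π * Real.sqrt lam)
  have e1 : 2 * Real.cosh (π * Real.sqrt lamstar)
      - 2 * (π * Real.sqrt lamstar) * Real.sinh (π * Real.sqrt lamstar) = 1 := by
    field_simp at hstar
    linarith
  have e2 : CM lam < CS lam ↔ 1 < 2 * Real.cosh (π * Real.sqrt lam)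
      - 2 * (π * Real.sqrt lam) * Real.sinh (π * Real.sqrt lam) := by
    unfold CM CS
    rw [div_div, div_lt_div_iff₀ (by linarith) (by positivity)]
    constructor <;> intro h <;> linarith
  rw [e2, ← e1]
  have := g_anti.lt_iff_gt (a := π * Real.sqrt lamstar) (b := π * Real.sqrt lam) hts.le ht.le
  rw [show lam < lamstar ↔ π * Real.sqrt lam < π * Real.sqrt lamstar by
    rw [mul_lt_mul_iff_right₀ hp, Real.sqrt_lt_sqrt_iff hlam.le]]
  exact this.symm
end

section
/- For every real z > 0, (2·cosh(z) − 1)·sinh(z) < z·cosh(2z). -/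
open Real

lemma aux_pos (f g : ℝ → ℝ) (h : ∀ x, HasDerivAt f (g x) x) (h0 : f 0 = 0)
    (hg : ∀ x, 0 < x → 0 < g x) (z : ℝ) (hz : 0 < z) : 0 < f z := by
  have hm : StrictMonoOn f (Set.Ici 0) := by
    apply strictMonoOn_of_deriv_pos (convex_Ici 0)
    · exact fun x _ => (h x).continuousAt.continuousWithinAt
    · intro x hx
      rw [interior_Ici] at hx
      rw [(h x).deriv]
      exact hg x hx
  have := hm (Set.mem_Ici.2 le_rfl) (Set.mem_Ici.2 hz.le) hz
  rwa [h0] at this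

/-- For every real `z > 0`, `(2 cosh(z) − 1) sinh(z) < z cosh(2z)`. -/
theorem stmt17 (z : ℝ) (hz : 0 < z) :
    (2 * Real.cosh z - 1) * Real.sinh z < z * Real.cosh (2 * z) := by
  have hl : ∀ x : ℝ, HasDerivAt (fun x : ℝ => 2 * x) 2 x := fun x => by
    simpa using (hasDerivAt_id x).const_mul (2 : ℝ)
  have hc : ∀ x : ℝ, HasDerivAt (fun x : ℝ => Real.cosh (2 * x)) (Real.sinh (2 * x) * 2) x :=
    fun x => (hl x).cosh
  have hs : ∀ x : ℝ, HasDerivAt (fun x : ℝ => Real.sinh (2 * x)) (Real.cosh (2 * x) * 2) x :=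
    fun x => (hl x).sinh
  have h1 := aux_pos (fun x => 2 * x * Real.sinh (2 * x) - Real.cosh (2 * x) + Real.cosh x)
    (fun x => 4 * x * Real.cosh (2 * x) + Real.sinh x)
    (fun x => by
      refine ((((hl x).mul (hs x)).sub (hc x)).add (Real.hasDerivAt_cosh x)).congr_deriv ?_
      ring)
    (by simp)
    (fun x hx => by
      have := Real.sinh_pos_iff.2 hx
      have := Real.cosh_pos (2 * x)
      positivity)
  have h2 := aux_pos (fun x => x * Real.cosh (2 * x) - Real.sinh (2 * x) + Real.sinh x)
    (fun x => 2 * x * Real.sinh (2 * x) - Real.cosh (2 * x) + Real.cosh x)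
    (fun x => by
      refine ((((hasDerivAt_id x).mul (hc x)).sub (hs x)).add
        (Real.hasDerivAt_sinh x)).congr_deriv ?_
      simp only [id]
      ring)
    (by simp) h1 z hz
  have h3 := Real.sinh_two_mul z
  nlinarith
end

section
/- For every λ > 0, (1 − sech(2π√λ))/(2λ) < min{C_M(λ), C_S(λ)} · sinh(π√λ)/√λ. (In other words, the mean of the maximal coupling time from antipodal starting points is strictly smaller than the mean of the optimal co-adapted coupling time, for every positive jump rate.) -/
open Real

theorem aux_pos_s18 {f f' : ℝ → ℝ} (hd : ∀ x, HasDerivAt f (f' x) x) (h0 : f 0 = 0)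
    (hp : ∀ x, 0 < x → 0 < f' x) (u : ℝ) (hu : 0 < u) : 0 < f u := by
  have hm : StrictMonoOn f (Set.Ici 0) := by
    apply strictMonoOn_of_deriv_pos (convex_Ici 0)
    · exact fun x _ => (hd x).continuousAt.continuousWithinAt
    · intro x hx
      rw [interior_Ici] at hx
      rw [(hd x).deriv]
      exact hp x hx
  have := hm (Set.mem_Ici.2 le_rfl) (Set.mem_Ici.2 hu.le) hu
  rwa [h0] at this

theorem aux_key (u : ℝ) (hu : 0 < u) :
    0 < u * Real.cosh (2 * u) - Real.sinh (2 * u) + Real.sinh u := by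
  have h2 : ∀ x : ℝ, HasDerivAt (fun y : ℝ => 2 * y) 2 x := fun x => by
    simpa using (hasDerivAt_id x).const_mul 2
  refine aux_pos_s18 (f := fun u => u * Real.cosh (2 * u) - Real.sinh (2 * u) + Real.sinh u)
    (f' := fun u => 2 * u * Real.sinh (2 * u) - Real.cosh (2 * u) + Real.cosh u) ?_ (by simp) ?_ u hu
  · intro x
    have := (((hasDerivAt_id x).mul (h2 x).cosh).sub (h2 x).sinh).add (Real.hasDerivAt_sinh x)
    refine this.congr_deriv ?_
    simp only [id]
    ring
  · refine aux_pos_s18 (f' := fun u => 4 * u * Real.cosh (2 * u) + Real.sinh u) ?_ (by simp) ?_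
    · intro x
      have := (((h2 x).mul (h2 x).sinh).sub (h2 x).cosh).add (Real.hasDerivAt_cosh x)
      refine this.congr_deriv ?_
      ring
    · intro x hx
      have := Real.sinh_pos_iff.2 hx
      have := Real.cosh_pos (2 * x)
      positivity

/-- For every `λ > 0`, `(1 − sech(2π√λ))/(2λ) < min{C_M(λ), C_S(λ)} · sinh(π√λ)/√λ`:
the mean maximal coupling time from antipodal points is strictly smaller than the mean
of the optimal co-adapted coupling time. -/
theorem stmt18 (lam : ℝ) (hlam : 0 < lam) :
    (1 - 1 / Real.cosh (2 * π * Real.sqrt lam)) / (2 * lam)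
      < min (CM lam) (CS lam) * Real.sinh (π * Real.sqrt lam) / Real.sqrt lam := by
  obtain ⟨s, hs, rfl⟩ : ∃ s : ℝ, 0 < s ∧ lam = s ^ 2 :=
    ⟨Real.sqrt lam, Real.sqrt_pos.2 hlam, (Real.sq_sqrt hlam.le).symm⟩
  unfold CM CS
  rw [Real.sqrt_sq hs.le]
  have hu : 0 < π * s := by positivity
  have hS := Real.sinh_pos_iff.2 hu
  have hC := Real.one_le_cosh (π * s)
  have hD := Real.cosh_pos (2 * (π * s))
  have hk := aux_key _ hu
  rw [mul_assoc 2 π s]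
  rcases min_choice (π / (2 * Real.cosh (π * s) - 1))
    ((1 / Real.sinh (π * s)) / (2 * s)) with h | h <;> rw [h]
  · have hE : 0 < 2 * Real.cosh (π * s) - 1 := by linarith
    have h1 : 1 - 1 / Real.cosh (2 * (π * s))
        = 2 * Real.sinh (π * s) ^ 2 / Real.cosh (2 * (π * s)) := by
      rw [eq_div_iff hD.ne', sub_mul, one_div_mul_cancel hD.ne', Real.cosh_two_mul,
        Real.cosh_sq]
      ring
    rw [Real.sinh_two_mul] at hk
    rw [h1, div_div, div_mul_eq_mul_div, div_div, div_lt_div_iff₀ (by positivity) (by positivity)]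
    have : 0 < 2 * s * Real.sinh (π * s) * (π * s * Real.cosh (2 * (π * s)) -
      2 * Real.sinh (π * s) * Real.cosh (π * s) + Real.sinh (π * s)) := by positivity
    linarith
  · have h1 : 1 / Real.sinh (π * s) / (2 * s) * Real.sinh (π * s) / s = 1 / (2 * s ^ 2) := by
      field_simp
    rw [h1]
    have : 0 < 1 / Real.cosh (2 * (π * s)) := by positivity
    gcongr
    linarith
end
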